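/- Let 0 < ε < 1 and C > 0 be constants. There exist constants r₀ and c (depending only on C and ε) such that the following holds for all sufficiently large n. Let A = (a_{ij}) be an n×n symmetric real matrix with ρ_q(A) ≥ n^{−C}. Then there exist a set I₀ ⊆ {1,…,n} with |I₀| ≤ r₀, a set I ⊆ {1,…,n} with |I| ≥ n − 2n^ε, and a nonzero integer k with |k| ≤ n^c, such that for every i ∈ I there exist integers k_{i i₀} (i₀ ∈ I₀) of absolute value at most n^c, an index set J_i ⊆ {1,…,n} with |J_i| ≥ n − n^ε, and a proper symmetric GAP Q_i of rank at most r₀ and size at most n^c, such that k·a_{ij} + Σ_{i₀∈I₀} k_{i i₀}·a_{i₀ j} ∈ Q_i for all j ∈ J_i. -/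

import Mathlib

open scoped Classical BigOperators

noncomputable section

/-- `Q` is a proper symmetric generalized arithmetic progression (GAP) of rank at most `r`
and size at most `s`. -/
def IsProperSymGAPSet (Q : Set ℝ) (r : ℕ) (s : ℝ) : Prop :=
  ∃ (r' : ℕ) (g : Fin r' → ℝ) (N : Fin r' → ℕ),
    r' ≤ r ∧
    Q = {x : ℝ | ∃ m : Fin r' → ℤ, (∀ i, |m i| ≤ (N i : ℤ)) ∧ x = ∑ i, (m i : ℝ) * g i} ∧
    (∀ m m' : Fin r' → ℤ, (∀ i, |m i| ≤ (N i : ℤ)) → (∀ i, |m' i| ≤ (N i : ℤ)) →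
      (∑ i, (m i : ℝ) * g i) = (∑ i, (m' i : ℝ) * g i) → m = m') ∧
    (∏ i, (2 * (N i : ℝ) + 1)) ≤ s

/-- The real number (±1) corresponding to a Boolean sign bit. -/
def signv (b : Bool) : ℝ := if b then 1 else -1

/-- The quadratic concentration probability `ρ_q(A) = sup_a P(Σ a_{ij} x_i x_j = a)`, where
`x` is a vector of iid Rademacher random variables. -/
def rhoQ (n : ℕ) (A : Matrix (Fin n) (Fin n) ℝ) : ℝ :=
  ⨆ a : ℝ, ((Finset.univ.filter fun x : Fin n → Bool =>
      ∑ i, ∑ j, A i j * signv (x i) * signv (x j) = a).card : ℝ) / 2 ^ n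

theorem exists_killer_or_large_injective_family {M ι : Type*} [AddCommGroup M] [Fintype ι]
    (u : ι → M) (k b N K : ℕ) (hk : 2 ≤ k) (hb : 1 ≤ b) (hN : 1 ≤ N) (hK : K ≤ k ^ b)
    (hu : ∀ i, ∃ q : ℕ, 1 ≤ q ∧ q ≤ K ∧ q • u i = 0) (t : ℕ) :
    (∃ D : ℕ, 1 ≤ D ∧ D ≤ N ^ b ∧ ∀ i, D • u i = 0) ∨
    (∃ (E : Finset (ι → ℕ)) (D : ℕ), N < E.card ∧ 1 ≤ D ∧ D ≤ (k * N) ^ b ∧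
      (∀ z ∈ E, ∑ i, z i ≤ t * k) ∧ Set.InjOn (fun z : ι → ℕ => ∑ i, z i • u i) E ∧
      ∀ z ∈ E, D • ∑ i, z i • u i = 0) ∨
    (∃ (E : Finset (ι → ℕ)) (D : ℕ) (H : AddSubgroup M), 2 ^ t ≤ E.card ∧ E.card ≤ N ∧
      1 ≤ D ∧ D ≤ E.card ^ b ∧
      (∀ z ∈ E, ∑ i, z i ≤ t * k) ∧ Set.InjOn (fun z : ι → ℕ => ∑ i, z i • u i) E ∧
      (∀ z ∈ E, ∑ i, z i • u i ∈ H) ∧ ∀ h ∈ H, D • h = 0) := by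
  induction t with
  | zero =>
    right; right
    refine ⟨{0}, 1, ⊥, by simp, by simpa using hN, le_rfl, by simp, by simp, by simp, by simp, ?_⟩
    simp
  | succ t ih =>
    rcases ih with h | ⟨E, D, h1, h2, h3, h4, h5, h6⟩ | ⟨E, D, H, h1, h2, h3, h4, h5, h6, h7, h8⟩
    · exact Or.inl h
    · exact Or.inr (Or.inl ⟨E, D, h1, h2, h3, fun z hz => (h4 z hz).trans (by gcongr; omega),
        h5, h6⟩)
    by_cases hall : ∀ i, u i ∈ H
    · exact Or.inl ⟨D, h3, h4.trans (Nat.pow_le_pow_left h2 b), fun i => h8 _ (hall i)⟩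
    push Not at hall
    obtain ⟨i, hi⟩ := hall
    have hex : ∃ q : ℕ, 1 ≤ q ∧ q • u i ∈ H := by
      obtain ⟨q, hq, -, hq'⟩ := hu i
      exact ⟨q, hq, by rw [hq']; exact H.zero_mem⟩
    obtain ⟨q, hq⟩ : ∃ q, q = Nat.find hex := ⟨_, rfl⟩
    have hq1 : 1 ≤ q ∧ q • u i ∈ H := hq ▸ Nat.find_spec hex
    have hqmin : ∀ j : ℕ, 1 ≤ j → j < q → j • u i ∉ H := fun j hj hjq hj' =>
      Nat.find_min hex (hq ▸ hjq) ⟨hj, hj'⟩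
    have hqK : q ≤ K := by
      obtain ⟨q', hq', hq'K, hq'0⟩ := hu i
      rw [hq]
      exact (Nat.find_min' hex ⟨hq', by rw [hq'0]; exact H.zero_mem⟩).trans hq'K
    have hq2 : 2 ≤ q := by
      rcases hq1.1.lt_or_eq with h | h
      · exact h
      · exact absurd (by simpa [← h] using hq1.2) hi
    set r := min q k with hr
    have hr2 : 2 ≤ r := le_min hq2 hk
    have hqr : q ≤ r ^ b := by
      rcases le_total q k with h | h
      · rw [hr, min_eq_left h]
        exact Nat.le_self_pow (by omega) q
      · rw [hr, min_eq_right h]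
        exact hqK.trans hK
    set F : (ι → ℕ) × ℕ → (ι → ℕ) := fun p => p.1 + Pi.single i p.2 with hF
    have heval : ∀ p, ∑ i', (F p) i' • u i' = ∑ i', p.1 i' • u i' + p.2 • u i := by
      intro p
      simp only [hF, Pi.add_apply, add_smul, Finset.sum_add_distrib, add_right_inj]
      rw [Finset.sum_eq_single i] <;> simp +contextual
    have hlt : ∀ z ∈ E, ∀ z' ∈ E, ∀ j j' : ℕ, j < j' → j' < r →
        ∑ i', z i' • u i' + j • u i ≠ ∑ i', z' i' • u i' + j' • u i := by
      intro z hz z' hz' j j' hjj hj' heq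
      apply hqmin (j' - j) (by omega) (by omega)
      have : (j' - j) • u i = ∑ i', z i' • u i' - ∑ i', z' i' • u i' := by
        rw [sub_nsmul _ hjj.le, ← sub_eq_add_neg, sub_eq_sub_iff_add_eq_add, add_comm,
          ← heq, add_comm]
      rw [this]
      exact H.sub_mem (h7 z hz) (h7 z' hz')
    have hinj : Set.InjOn (fun p => ∑ i', (F p) i' • u i') (E ×ˢ Finset.range r : Finset _) := by
      rintro ⟨z, j⟩ hz ⟨z', j'⟩ hz' heq
      simp only [Finset.coe_product, Set.mem_prod, Finset.mem_coe, Finset.mem_range] at hz hz'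
      simp only [heval] at heq
      rcases lt_trichotomy j j' with h | h | h
      · exact absurd heq (hlt _ hz.1 _ hz'.1 _ _ h hz'.2)
      · subst h
        rw [h6 hz.1 hz'.1 (add_right_cancel heq)]
      · exact absurd heq.symm (hlt _ hz'.1 _ hz.1 _ _ h hz.2)
    have hcard : ((E ×ˢ Finset.range r).image F).card = E.card * r := by
      rw [Finset.card_image_of_injOn (fun p hp p' hp' h => hinj hp hp' (by simp only [h])),
        Finset.card_product, Finset.card_range]
    have hmass : ∀ z ∈ (E ×ˢ Finset.range r).image F, ∑ i, z i ≤ (t + 1) * k := by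
      intro z hz
      obtain ⟨⟨z, j⟩, hp, rfl⟩ := Finset.mem_image.1 hz
      simp only [Finset.mem_product, Finset.mem_range] at hp
      have := h5 z hp.1
      have hjk : j ≤ k := hp.2.le.trans (min_le_right _ _)
      simp only [hF, Pi.add_apply, Finset.sum_add_distrib, Finset.sum_pi_single', Finset.mem_univ,
        if_true]
      linarith
    have hinj' : Set.InjOn (fun z : ι → ℕ => ∑ i, z i • u i)
        ((E ×ˢ Finset.range r).image F : Finset _) := by
      intro z hz z' hz' heq
      obtain ⟨p, hp, rfl⟩ := Finset.mem_image.1 (Finset.mem_coe.1 hz)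
      obtain ⟨p', hp', rfl⟩ := Finset.mem_image.1 (Finset.mem_coe.1 hz')
      rw [hinj hp hp' heq]
    have hD : q * D ≤ (E.card * r) ^ b := by
      rw [mul_pow, mul_comm]
      exact Nat.mul_le_mul h4 hqr
    have hmem : ∀ z ∈ (E ×ˢ Finset.range r).image F,
        ∑ i, z i • u i ∈ H ⊔ AddSubgroup.zmultiples (u i) := by
      intro z hz
      obtain ⟨⟨z, j⟩, hp, rfl⟩ := Finset.mem_image.1 hz
      rw [heval]
      exact AddSubgroup.add_mem_sup (h7 z (Finset.mem_product.1 hp).1)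
        (AddSubgroup.nsmul_mem_zmultiples _ _)
    have hkill : ∀ h ∈ H ⊔ AddSubgroup.zmultiples (u i), (q * D) • h = 0 := by
      intro h hh
      obtain ⟨a, ha, c, hc, rfl⟩ := AddSubgroup.mem_sup.1 hh
      obtain ⟨j, rfl⟩ := AddSubgroup.mem_zmultiples_iff.1 hc
      rw [smul_add, mul_smul, h8 a ha |> fun h => (by rw [h, smul_zero] : q • D • a = 0),
        smul_comm (q * D) j, mul_comm, mul_smul, h8 _ hq1.2, smul_zero, add_zero]
    have hqD : 1 ≤ q * D := Nat.mul_pos hq1.1 h3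
    rcases lt_or_ge N (E.card * r) with h | h
    · refine Or.inr (Or.inl ⟨(E ×ˢ Finset.range r).image F, q * D, hcard ▸ h, hqD,
        hD.trans (Nat.pow_le_pow_left ?_ b), hmass, hinj', fun z hz => hkill _ (hmem z hz)⟩)
      rw [mul_comm]
      exact Nat.mul_le_mul (min_le_right _ _) h2
    · refine Or.inr (Or.inr ⟨(E ×ˢ Finset.range r).image F, q * D, _, ?_, hcard ▸ h, hqD,
        hcard ▸ hD, hmass, hinj', hmem, hkill⟩)
      rw [hcard, pow_succ]
      exact Nat.mul_le_mul h1 hr2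

/-- The family `y ∘ w` has no nontrivial integer relation with coefficients bounded by `L`. -/
def Dissociated {ι : Type} (y : ι → ℝ) {d : ℕ} (w : Fin d → ι) (L : ℕ) : Prop :=
  ∀ c : Fin d → ℤ, (∀ l, |c l| ≤ (L : ℤ)) → ∑ l, (c l : ℝ) * y (w l) = 0 → c = 0

/-- Integer combinations of `y` of length at most `m` take at most `N` distinct values. -/
def FewSums {ι : Type} [Fintype ι] (y : ι → ℝ) (m N : ℕ) : Prop :=
  ∀ E : Finset (ι → ℤ), (∀ z ∈ E, ∑ i, |z i| ≤ (m : ℤ)) →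
    Set.InjOn (fun z : ι → ℤ => ∑ i, (z i : ℝ) * y i) E → E.card ≤ N

/-- Every `y i` has a positive multiple `D * y i`, with `D ≤ S` independent of `i`, which is an
integer combination of `y ∘ w` with coefficients bounded by `S`. -/
def CommonDenominator {ι : Type} (y : ι → ℝ) {d : ℕ} (w : Fin d → ι) (S : ℕ) : Prop :=
  ∃ D : ℕ, 1 ≤ D ∧ D ≤ S ∧ ∀ i, ∃ κ : Fin d → ℤ, (∀ l, |κ l| ≤ (S : ℤ)) ∧
    (D : ℝ) * y i = ∑ l, (κ l : ℝ) * y (w l)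

theorem commonDenominator_of_dissociated {ι : Type} [Fintype ι] (y : ι → ℝ) {d : ℕ}
    (w : Fin d → ι) (R k b : ℕ) (hk : 2 ≤ k) (hb : 1 ≤ b) (hkR : k ^ (2 * R) < 2 ^ k)
    (hy : FewSums y (k ^ 2) (k ^ (2 * R)))
    (hw : Dissociated y w (k ^ (3 + (2 * R + 2) * b)))
    (hrel : ∀ i, ∃ (q : ℕ) (c : Fin d → ℤ), 1 ≤ q ∧ q ≤ k ^ b ∧ (∀ l, |c l| ≤ ((k ^ b : ℕ) : ℤ)) ∧
      (q : ℝ) * y i = ∑ l, (c l : ℝ) * y (w l)) :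
    CommonDenominator y w (k ^ (3 + (2 * R + 2) * b)) := by
  choose q c hq1 hqK hcK hqc using hrel
  set u : ι → Fin d → ℚ := fun i l => (c i l : ℚ) / q i with hu
  have hq0 : ∀ i, (0 : ℚ) < q i := fun i => by exact_mod_cast hq1 i
  have huK : ∀ i l, |u i l| ≤ (k ^ b : ℕ) := by
    intro i l
    rw [hu]
    simp only [abs_div, Nat.abs_cast]
    rw [div_le_iff₀ (hq0 i)]
    have h1 : |(c i l : ℚ)| ≤ (k ^ b : ℕ) := by exact_mod_cast hcK i l
    have h2 : (1 : ℚ) ≤ q i := by exact_mod_cast hq1 i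
    exact h1.trans (le_mul_of_one_le_right (by positivity) h2)
  have hyu : ∀ i, y i = ∑ l, (u i l : ℝ) * y (w l) := by
    intro i
    have h0 : (q i : ℝ) ≠ 0 := by exact_mod_cast (hq0 i).ne'
    have : y i = (∑ l, (c i l : ℝ) * y (w l)) / q i := by
      rw [← hqc i]; field_simp
    rw [this, Finset.sum_div]
    refine Finset.sum_congr rfl fun l _ => ?_
    simp only [hu]; push_cast; ring
  have hcomb : ∀ z : ι → ℝ, ∑ i, z i * y i = ∑ l, (∑ i, z i * (u i l : ℝ)) * y (w l) := by
    intro z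
    simp_rw [Finset.sum_mul]
    rw [Finset.sum_comm]
    refine Finset.sum_congr rfl fun i _ => ?_
    conv_lhs => rw [hyu i, Finset.mul_sum]
    exact Finset.sum_congr rfl fun l _ => by ring
  set u' : ι → Fin d → AddCircle (1 : ℚ) := fun i l => (u i l : AddCircle (1 : ℚ)) with hu'
  have hcoe_zero : ∀ x : ℚ, (x : AddCircle (1 : ℚ)) = 0 ↔ ∃ n : ℤ, (n : ℚ) = x := by
    intro x
    rw [AddCircle.coe_eq_zero_iff]
    simp
  have hkpos : 0 < k := by omega
  rcases exists_killer_or_large_injective_family u' k b (k ^ (2 * R)) (k ^ b) hk hb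
    (Nat.pos_of_ne_zero (by positivity)) le_rfl (by
      intro i
      refine ⟨q i, hq1 i, hqK i, ?_⟩
      funext l
      simp only [hu', Pi.smul_apply, Pi.zero_apply]
      rw [← AddCircle.coe_nsmul, hcoe_zero]
      refine ⟨c i l, ?_⟩
      simp only [hu, nsmul_eq_mul]
      field_simp [(hq0 i).ne']) k with h | h | h
  · obtain ⟨D, hD1, hD2, hD3⟩ := h
    have hDS : D * k ^ b ≤ k ^ (3 + (2 * R + 2) * b) := by
      calc D * k ^ b ≤ (k ^ (2 * R)) ^ b * k ^ b := by gcongr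
        _ = k ^ (2 * R * b + b) := by rw [← pow_mul, ← pow_add]
        _ ≤ _ := Nat.pow_le_pow_right hkpos (by nlinarith)
    refine ⟨D, hD1, le_trans (Nat.le_mul_of_pos_right D (by positivity)) hDS, fun i => ?_⟩
    have : ∀ l, ∃ n : ℤ, (n : ℚ) = D * u i l := by
      intro l
      have := congrFun (hD3 i) l
      simp only [hu', Pi.smul_apply, Pi.zero_apply] at this
      rw [← AddCircle.coe_nsmul, hcoe_zero] at this
      simpa using this
    choose κ hκ using this
    refine ⟨κ, fun l => ?_, ?_⟩
    · have h1 : |(κ l : ℚ)| ≤ D * (k ^ b : ℕ) := by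
        rw [hκ, abs_mul, Nat.abs_cast]
        exact mul_le_mul_of_nonneg_left (huK i l) (by positivity)
      have h2 : |κ l| ≤ ((D * k ^ b : ℕ) : ℤ) := by exact_mod_cast h1
      exact h2.trans (by exact_mod_cast hDS)
    · conv_lhs => rw [hyu i, Finset.mul_sum]
      refine Finset.sum_congr rfl fun l _ => ?_
      have : ((κ l : ℚ) : ℝ) = ((D * u i l : ℚ) : ℝ) := by rw [hκ]
      push_cast at this
      rw [this]; ring
  · exfalso
    obtain ⟨E, D, hE, hD1, hD2, hmass, hinj, hkill⟩ := h
    have key : Set.InjOn (fun z : ι → ℕ => ∑ i, (z i : ℝ) * y i) E := by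
      intro z hz z' hz' heq
      apply hinj hz hz'
      have hmz := hmass z hz
      have hmz' := hmass z' hz'
      have hex : ∀ z ∈ E, ∀ l, ∃ n : ℤ, (n : ℚ) = D * ∑ i, z i * u i l := by
        intro z hz l
        have := congrFun (hkill z hz) l
        simp only [hu', Pi.smul_apply, Pi.zero_apply, Finset.sum_apply] at this
        have h2 : ((D • ∑ i, z i • u i l : ℚ) : AddCircle (1 : ℚ)) = 0 := by
          rw [← this, AddCircle.coe_nsmul]
          congr 1
          rw [← QuotientAddGroup.mk'_apply, map_sum]
          simp
        rw [hcoe_zero] at h2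
        simpa using h2
      choose n hn using hex z hz
      choose n' hn' using hex z' hz'
      have hsmall : ∀ z : ι → ℕ, ∑ i, z i ≤ k * k → ∀ l,
          |(D : ℚ) * ∑ i, (z i : ℚ) * u i l| ≤ D * (k * k * k ^ b) := by
        intro z hz l
        rw [abs_mul, Nat.abs_cast]
        gcongr
        calc |∑ i, (z i : ℚ) * u i l| ≤ ∑ i, |(z i : ℚ) * u i l| := Finset.abs_sum_le_sum_abs _ _
          _ ≤ ∑ i, (z i : ℚ) * (k ^ b : ℕ) := by
            refine Finset.sum_le_sum fun i _ => ?_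
            rw [abs_mul, Nat.abs_cast]
            exact mul_le_mul_of_nonneg_left (huK i l) (by positivity)
          _ = ((∑ i, z i : ℕ) : ℚ) * (k ^ b : ℕ) := by push_cast; rw [Finset.sum_mul]
          _ ≤ ((k * k : ℕ) : ℚ) * (k ^ b : ℕ) := by gcongr
          _ = _ := by push_cast; ring
      have hDL : D * (k * k * k ^ b) + D * (k * k * k ^ b) ≤ k ^ (3 + (2 * R + 2) * b) := by
        calc D * (k * k * k ^ b) + D * (k * k * k ^ b) = 2 * (D * (k * k * k ^ b)) := by ring
          _ ≤ k * ((k * k ^ (2 * R)) ^ b * (k * k * k ^ b)) := by gcongr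
          _ = _ := by rw [mul_pow, ← pow_mul]; ring
      have hzero : (fun l => n l - n' l) = 0 := by
        apply hw
        · intro l
          have h1 := hsmall z hmz l
          have h2 := hsmall z' hmz' l
          rw [← hn] at h1
          rw [← hn'] at h2
          have h3 : |((n l - n' l : ℤ) : ℚ)| ≤ (k ^ (3 + (2 * R + 2) * b) : ℕ) := by
            push_cast
            calc |(n l : ℚ) - n' l| ≤ |(n l : ℚ)| + |(n' l : ℚ)| := abs_sub _ _
              _ ≤ _ := (add_le_add h1 h2).trans (by exact_mod_cast hDL)
          exact_mod_cast h3
        · have e1 := hcomb (fun i => (z i : ℝ))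
          have e2 := hcomb (fun i => (z' i : ℝ))
          simp only at heq
          have : ∀ l, ((n l - n' l : ℤ) : ℝ) =
              D * (∑ i, (z i : ℝ) * (u i l : ℝ)) - D * (∑ i, (z' i : ℝ) * (u i l : ℝ)) := by
            intro l
            have h1 : ((n l : ℚ) : ℝ) = _ := congrArg _ (hn l)
            have h2 : ((n' l : ℚ) : ℝ) = _ := congrArg _ (hn' l)
            push_cast at h1 h2 ⊢
            rw [h1, h2]
          simp_rw [this, sub_mul, Finset.sum_sub_distrib, mul_assoc, ← Finset.mul_sum]
          rw [← e1, ← e2, heq, sub_self]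
      funext l
      have h1 : n l = n' l := by
        have := congrFun hzero l
        simpa [sub_eq_zero] using this
      have h2 : ∑ i, (z i : ℚ) * u i l = ∑ i, (z' i : ℚ) * u i l := by
        have h3 := hn l
        rw [h1, hn' l] at h3
        have : (D : ℚ) ≠ 0 := by positivity
        exact (mul_left_cancel₀ this h3).symm
      have h3 : ∀ z : ι → ℕ, (∑ i, z i • u' i) l =
          ((∑ i, (z i : ℚ) * u i l : ℚ) : AddCircle (1 : ℚ)) := by
        intro z
        rw [Finset.sum_apply, ← QuotientAddGroup.mk'_apply, map_sum]
        simp [hu', ← nsmul_eq_mul]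
      simp only [h3, h2]
    set f : (ι → ℕ) → (ι → ℤ) := fun z i => (z i : ℤ) with hf
    have hfinj : Function.Injective f := fun z z' h => by
      funext i
      have := congrFun h i
      simpa [hf] using this
    have := hy (E.image f) (by
      intro a ha
      obtain ⟨z, hz, rfl⟩ := Finset.mem_image.1 ha
      have := hmass z hz
      simp only [hf, Nat.abs_cast]
      rw [sq]
      exact_mod_cast this) (by
      intro a ha a' ha' heq
      obtain ⟨z, hz, rfl⟩ := Finset.mem_image.1 (Finset.mem_coe.1 ha)
      obtain ⟨z', hz', rfl⟩ := Finset.mem_image.1 (Finset.mem_coe.1 ha')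
      rw [key hz hz' (by simpa [hf] using heq)])
    rw [Finset.card_image_of_injective _ hfinj] at this
    omega
  · exfalso
    obtain ⟨E, -, -, h1, h2, -⟩ := h
    omega

theorem not_dissociated_of_fewSums {ι : Type} [Fintype ι] (y : ι → ℝ) (R k : ℕ)
    (hk : (R + 1) ^ (R + 1) < k ^ 2) (hk' : R + 1 ≤ k)
    (hy : FewSums y (k ^ 2) (k ^ (2 * R))) (w : Fin (R + 1) → ι) :
    ¬ Dissociated y w (k ^ 2) := by
  intro hw
  set M := k ^ 2 / (R + 1) with hM
  set f : (Fin (R + 1) → ℕ) → (ι → ℤ) := fun c i => ∑ l, if w l = i then (c l : ℤ) else 0 with hf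
  have heval : ∀ c, ∑ i, ((f c i : ℤ) : ℝ) * y i = ∑ l, (c l : ℝ) * y (w l) := by
    intro c
    simp only [hf, Int.cast_sum, Finset.sum_mul]
    rw [Finset.sum_comm]
    refine Finset.sum_congr rfl fun l _ => ?_
    simp
  have hM1 : M * (R + 1) ≤ k ^ 2 := Nat.div_mul_le_self _ _
  have hMk : M ≤ k ^ 2 := Nat.div_le_self _ _
  set B : Finset (Fin (R + 1) → ℕ) := Fintype.piFinset fun _ => Finset.range (M + 1) with hB
  have hBmem : ∀ c ∈ B, ∀ l, c l ≤ M := by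
    intro c hc l
    have := Fintype.mem_piFinset.1 hc l
    rw [Finset.mem_range] at this
    omega
  have hinj : Set.InjOn (fun c : Fin (R + 1) → ℕ => ∑ i, ((f c i : ℤ) : ℝ) * y i) B := by
    intro c hc c' hc' heq
    have : (fun l => (c l : ℤ) - (c' l : ℤ)) = 0 := by
      apply hw
      · intro l
        have h1 := hBmem c hc l
        have h2 := hBmem c' hc' l
        rw [abs_le]
        constructor <;> push_cast <;> zify at h1 h2 hMk <;> omega
      · simp only [heval] at heq
        push_cast
        simp_rw [sub_mul, Finset.sum_sub_distrib]
        rw [heq, sub_self]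
    funext l
    have := congrFun this l
    simp only [Pi.zero_apply] at this
    omega
  have h := hy (B.image f) (by
    intro z hz
    obtain ⟨c, hc, rfl⟩ := Finset.mem_image.1 hz
    have : ∀ i, |f c i| = f c i := fun i =>
      abs_of_nonneg (Finset.sum_nonneg fun l _ => by split_ifs <;> simp)
    simp_rw [this, hf]
    rw [Finset.sum_comm]
    simp only [Finset.sum_ite_eq, Finset.mem_univ, if_true]
    calc ∑ l, (c l : ℤ) ≤ ∑ _l : Fin (R + 1), (M : ℤ) :=
          Finset.sum_le_sum fun l _ => by exact_mod_cast hBmem c hc l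
      _ = ((M * (R + 1) : ℕ) : ℤ) := by simp; ring
      _ ≤ _ := by exact_mod_cast hM1) (by
    intro a ha a' ha' heq
    obtain ⟨z, hz, rfl⟩ := Finset.mem_image.1 (Finset.mem_coe.1 ha)
    obtain ⟨z', hz', rfl⟩ := Finset.mem_image.1 (Finset.mem_coe.1 ha')
    rw [hinj hz hz' heq])
  rw [Finset.card_image_of_injOn (fun c hc c' hc' h => hinj hc hc' (by simp only [h])), hB,
    Fintype.card_piFinset] at h
  simp only [Finset.card_range, Finset.prod_const, Finset.card_univ, Fintype.card_fin] at h
  have h1 : k ^ 2 < (M + 1) * (R + 1) := by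
    have := Nat.lt_mul_div_succ (k ^ 2) (Nat.succ_pos R)
    rw [mul_comm]
    exact this
  have h2 : (k ^ 2) ^ (R + 1) < (k ^ 2) ^ (R + 1) := by
    calc (k ^ 2) ^ (R + 1) ≤ ((M + 1) * (R + 1)) ^ (R + 1) := Nat.pow_le_pow_left h1.le _
      _ = (M + 1) ^ (R + 1) * (R + 1) ^ (R + 1) := mul_pow _ _ _
      _ ≤ k ^ (2 * R) * (R + 1) ^ (R + 1) := Nat.mul_le_mul_right _ h
      _ < k ^ (2 * R) * k ^ 2 := Nat.mul_lt_mul_of_pos_left hk (by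
          have : 0 < k := by omega
          positivity)
      _ = _ := by ring
  exact lt_irrefl _ h2

/-- The exponents of the scales at which relations are considered. -/
def scaleExponent (R : ℕ) : ℕ → ℕ
  | 0 => 2
  | j + 1 => 3 + (2 * R + 2) * scaleExponent R j

theorem exists_commonDenominator {ι : Type} [Fintype ι] (y : ι → ℝ) (R k : ℕ) (hk2 : 2 ≤ k)
    (hk : (R + 1) ^ (R + 1) < k ^ 2) (hk' : R + 1 ≤ k) (hkR : k ^ (2 * R) < 2 ^ k)
    (hy : FewSums y (k ^ 2) (k ^ (2 * R))) :
    ∃ d ≤ R, ∃ w : Fin d → ι, CommonDenominator y w (k ^ scaleExponent R (R + 1)) := by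
  have hpos : ∀ j, 1 ≤ scaleExponent R j := fun j => by cases j <;> simp [scaleExponent]; omega
  have hmono : Monotone (scaleExponent R) := by
    refine monotone_nat_of_le_succ fun j => ?_
    simp only [scaleExponent]
    nlinarith
  have hkpow : ∀ {i j}, i ≤ j → k ^ scaleExponent R i ≤ k ^ scaleExponent R j := fun h =>
    Nat.pow_le_pow_right (by omega) (hmono h)
  by_contra hcon
  push Not at hcon
  have main : ∀ d ≤ R + 1, ∃ w : Fin d → ι, Dissociated y w (k ^ scaleExponent R (R + 1 - d)) := by
    intro d
    induction d with
    | zero => exact fun _ => ⟨Fin.elim0, fun c _ _ => Subsingleton.elim _ _⟩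
    | succ d ih =>
      intro hd
      obtain ⟨w, hw⟩ := ih (by omega)
      obtain ⟨j, hj⟩ : ∃ j, R + 1 - d = j + 1 := ⟨R - d, by omega⟩
      have hj' : R + 1 - (d + 1) = j := by omega
      rw [hj']
      rw [hj] at hw
      by_contra hno
      push Not at hno
      apply hcon d (by omega) w
      have hcd : CommonDenominator y w (k ^ scaleExponent R (j + 1)) := by
        apply commonDenominator_of_dissociated y w R k _ hk2 (hpos j) hkR hy hw
        intro i
        have hi := hno (Fin.cons i w)
        simp only [Dissociated] at hi
        push Not at hi
        obtain ⟨c, hcK, hc0, hcne⟩ := hi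
        rw [Fin.sum_univ_succ] at hc0
        simp only [Fin.cons_zero, Fin.cons_succ] at hc0
        have hne : c 0 ≠ 0 := by
          intro h0
          apply hcne
          have := hw (fun l => c l.succ) (fun l => (hcK _).trans (by
            exact_mod_cast hkpow (Nat.le_succ j))) (by simpa [h0] using hc0)
          funext l
          refine Fin.cases h0 (fun l => congrFun this l) l
        refine ⟨(c 0).natAbs, fun l => -(c 0).sign * c l.succ, ?_, ?_, ?_, ?_⟩
        · exact Int.natAbs_pos.2 hne
        · have := hcK 0
          rw [Int.abs_eq_natAbs] at this
          exact_mod_cast this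
        · intro l
          rw [abs_mul, abs_neg]
          have h1 := hcK l.succ
          have h2 : |(c 0).sign| = 1 := by
            rw [← Int.natCast_natAbs, Int.natAbs_sign_of_ne_zero hne]; rfl
          rw [h2, one_mul]
          exact h1
        · have h1 : ((c 0).natAbs : ℝ) = ((c 0).sign : ℝ) * (c 0 : ℝ) := by
            have := congrArg (Int.cast : ℤ → ℝ) (Int.sign_mul_self_eq_natAbs (c 0))
            simpa only [Int.cast_mul, Int.cast_natCast] using this.symm
          rw [h1, mul_assoc, eq_neg_of_add_eq_zero_left hc0, mul_neg, Finset.mul_sum,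
            ← Finset.sum_neg_distrib]
          exact Finset.sum_congr rfl fun l _ => by push_cast; ring
      obtain ⟨D, h1, h2, h3⟩ := hcd
      have hS : k ^ scaleExponent R (j + 1) ≤ k ^ scaleExponent R (R + 1) := hkpow (by omega)
      refine ⟨D, h1, h2.trans hS, fun i => ?_⟩
      obtain ⟨κ, h4, h5⟩ := h3 i
      exact ⟨κ, fun l => (h4 l).trans (by exact_mod_cast hS), h5⟩
  obtain ⟨w, hw⟩ := main (R + 1) le_rfl
  rw [Nat.sub_self] at hw
  exact not_dissociated_of_fewSums y R k hk hk' hy w hw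

/-- The difference, as an integer, of two bits. -/
def bitDiff (b b' : Bool) : ℤ := (if b then 1 else 0) - (if b' then 1 else 0)

theorem one_sub_re_sum_zsmul_le {G ι : Type*} [AddCommGroup G] [Finite G] [Fintype ι]
    (χ : AddChar G ℂ) (y : ι → G) (z : ι → ℤ) (m : ℕ) (hz : ∑ i, |z i| ≤ (m : ℤ)) :
    1 - (χ (∑ i, z i • y i)).re ≤ m * ∑ i, |(z i : ℝ)| * (1 - (χ (y i)).re) := by
  have hsq : ∀ x : G, ‖1 - χ x‖ ^ 2 = 2 * (1 - (χ x).re) := by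
    intro x
    have h1 : ‖χ x‖ ^ 2 = 1 := by rw [AddChar.norm_apply]; norm_num
    rw [← Complex.normSq_eq_norm_sq, Complex.normSq_apply] at *
    simp only [Complex.sub_re, Complex.sub_im, Complex.one_re, Complex.one_im]
    linarith
  have hnat : ∀ (k : ℕ) (w : ℂ), ‖w‖ = 1 → ‖1 - w ^ k‖ ≤ k * ‖1 - w‖ := by
    intro k w hw
    induction k with
    | zero => simp
    | succ k ih =>
      calc ‖1 - w ^ (k + 1)‖ = ‖(1 - w ^ k) + w ^ k * (1 - w)‖ := by ring_nf
        _ ≤ ‖1 - w ^ k‖ + ‖w ^ k * (1 - w)‖ := norm_add_le _ _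
        _ = ‖1 - w ^ k‖ + ‖1 - w‖ := by rw [norm_mul, norm_pow, hw]; simp
        _ ≤ _ := by push_cast; linarith
  have hzsmul : ∀ (k : ℤ) (x : G), ‖1 - χ (k • x)‖ ≤ |(k : ℝ)| * ‖1 - χ x‖ := by
    intro k x
    rcases Int.eq_nat_or_neg k with ⟨n, rfl | rfl⟩
    · rw [natCast_zsmul, AddChar.map_nsmul_eq_pow]
      simpa using hnat n (χ x) (AddChar.norm_apply _ _)
    · rw [neg_smul, natCast_zsmul, AddChar.map_neg_eq_conj, AddChar.map_nsmul_eq_pow]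
      have : ‖1 - (starRingEnd ℂ) (χ x ^ n)‖ = ‖1 - χ x ^ n‖ := by
        rw [← Complex.norm_conj]; simp
      rw [this]
      simpa using hnat n (χ x) (AddChar.norm_apply _ _)
  have hsum : ∀ s : Finset ι, ‖1 - χ (∑ i ∈ s, z i • y i)‖ ≤
      ∑ i ∈ s, |(z i : ℝ)| * ‖1 - χ (y i)‖ := by
    intro s
    induction s using Finset.induction_on with
    | empty => simp
    | insert i s hi ih =>
      rw [Finset.sum_insert hi, Finset.sum_insert hi, AddChar.map_add_eq_mul]
      calc ‖1 - χ (z i • y i) * χ (∑ i ∈ s, z i • y i)‖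
          = ‖(1 - χ (z i • y i)) + χ (z i • y i) * (1 - χ (∑ i ∈ s, z i • y i))‖ := by ring_nf
        _ ≤ ‖1 - χ (z i • y i)‖ + ‖χ (z i • y i) * (1 - χ (∑ i ∈ s, z i • y i))‖ :=
          norm_add_le _ _
        _ = ‖1 - χ (z i • y i)‖ + ‖1 - χ (∑ i ∈ s, z i • y i)‖ := by
          rw [norm_mul, AddChar.norm_apply, one_mul]
        _ ≤ _ := add_le_add (hzsmul _ _) ih
  have hm : ∑ i, |(z i : ℝ)| ≤ m := by exact_mod_cast hz
  have h1 : ‖1 - χ (∑ i, z i • y i)‖ ^ 2 ≤ m * ∑ i, |(z i : ℝ)| * ‖1 - χ (y i)‖ ^ 2 := by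
    calc ‖1 - χ (∑ i, z i • y i)‖ ^ 2 ≤ (∑ i, |(z i : ℝ)| * ‖1 - χ (y i)‖) ^ 2 := by
          gcongr; exact hsum _
      _ ≤ (∑ i, |(z i : ℝ)|) * ∑ i, |(z i : ℝ)| * ‖1 - χ (y i)‖ ^ 2 :=
          Finset.sum_sq_le_sum_mul_sum_of_sq_le_mul _ (fun _ _ => abs_nonneg _)
            (fun _ _ => by positivity) (fun _ _ => (by ring : _ = _).le)
      _ ≤ _ := mul_le_mul_of_nonneg_right hm (Finset.sum_nonneg fun _ _ => by positivity)
  rw [hsq] at h1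
  have h2 : ∑ i, |(z i : ℝ)| * ‖1 - χ (y i)‖ ^ 2 = 2 * ∑ i, |(z i : ℝ)| * (1 - (χ (y i)).re) := by
    rw [Finset.mul_sum]
    exact Finset.sum_congr rfl fun i _ => by rw [hsq]; ring
  rw [h2] at h1
  linarith

theorem sum_norm_sq_sum_addChar {G : Type*} [AddCommGroup G] [Fintype G]
    (Λ : Finset (AddChar G ℂ)) :
    ∑ x, ‖∑ χ ∈ Λ, χ x‖ ^ 2 = (Fintype.card G : ℝ) * Λ.card := by
  have h : ∀ x, ((‖∑ χ ∈ Λ, χ x‖ ^ 2 : ℝ) : ℂ) = ∑ χ ∈ Λ, ∑ ψ ∈ Λ, (χ - ψ) x := by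
    intro x
    push_cast
    rw [← Complex.mul_conj', map_sum, Finset.sum_mul_sum]
    refine Finset.sum_congr rfl fun χ _ => Finset.sum_congr rfl fun ψ _ => ?_
    rw [AddChar.sub_apply, AddChar.map_neg_eq_conj]
  have h2 : ((∑ x, ‖∑ χ ∈ Λ, χ x‖ ^ 2 : ℝ) : ℂ) = ((Fintype.card G : ℝ) * Λ.card : ℝ) := by
    rw [Complex.ofReal_sum]
    simp_rw [h]
    rw [Finset.sum_comm]
    simp_rw [Finset.sum_comm (s := Finset.univ) (t := Λ), AddChar.sum_eq_ite, sub_eq_zero]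
    simp
    ring
  exact_mod_cast h2

theorem norm_sum_addChar_bitDiff_le {G : Type*} [AddCommGroup G] [Finite G]
    (χ : AddChar G ℂ) (g : Bool → G) (σ : Bool) :
    ‖∑ s : Bool, ∑ x : Bool, ∑ x' : Bool, χ (bitDiff x x' • g s)‖ ≤
      8 * (1 - (1 - (χ (g σ)).re) / 4) := by
  have hre : ∀ x : G, |(χ x).re| ≤ 1 := fun x =>
    (Complex.abs_re_le_norm _).trans (AddChar.norm_apply χ x).le
  have h : ∑ s : Bool, ∑ x : Bool, ∑ x' : Bool, χ (bitDiff x x' • g s) =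
      ((4 + 2 * (χ (g true)).re + 2 * (χ (g false)).re : ℝ) : ℂ) := by
    have hc : ∀ x : G, χ x + (starRingEnd ℂ) (χ x) = 2 * ((χ x).re : ℂ) := fun x => by
      rw [Complex.add_conj]; push_cast; ring
    simp [bitDiff, AddChar.map_neg_eq_conj]
    linear_combination hc (g true) + hc (g false)
  rw [h, Complex.norm_real, Real.norm_eq_abs]
  have h1 := abs_le.1 (hre (g true))
  have h2 := abs_le.1 (hre (g false))
  rw [abs_of_nonneg (by linarith [h1.1, h2.1])]
  cases σ <;> linarith [h1.2, h2.2]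

theorem sum_prod_three {ι : Type*} [Fintype ι] (F : ι → Bool → Bool → Bool → ℂ) :
    ∑ t : (ι → Bool) × (ι → Bool) × (ι → Bool), ∏ i, F i (t.1 i) (t.2.1 i) (t.2.2 i) =
      ∏ i, ∑ s, ∑ x, ∑ x', F i s x x' := by
  have h : ∀ i, ∑ s, ∑ x, ∑ x', F i s x x' =
      ∑ τ : Bool × Bool × Bool, F i τ.1 τ.2.1 τ.2.2 := by
    intro i
    simp_rw [Fintype.sum_prod_type]
  simp_rw [h, Finset.prod_univ_sum, Fintype.piFinset_univ]
  let e : (ι → Bool × Bool × Bool) ≃ (ι → Bool) × (ι → Bool) × (ι → Bool) :=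
    (Equiv.arrowProdEquivProdArrow ι _ _).trans
      (Equiv.prodCongr (Equiv.refl _) (Equiv.arrowProdEquivProdArrow ι _ _))
  exact (Fintype.sum_equiv e _ _ fun _ => rfl).symm

theorem exists_fewSums_of_concentration {G ι : Type} [AddCommGroup G] [Fintype G] [Fintype ι]
    (g : Bool → ι → G) (σ : Bool) (p lam δ : ℝ) (m : ℕ) (hp : 0 < p)
    (hlam : Real.exp (-lam / 4) ≤ p / 2) (hδ : (m : ℝ) ^ 2 * δ ≤ 1 / 2)
    (hcount : p * 8 ^ Fintype.card ι ≤
      ((Finset.univ.filter fun t : (ι → Bool) × (ι → Bool) × (ι → Bool) =>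
        ∑ i, bitDiff (t.2.1 i) (t.2.2 i) • g (t.1 i) i = 0).card : ℝ)) :
    ∃ X : Finset ι, (Xᶜ.card : ℝ) * δ ≤ lam ∧
      ∀ E : Finset (X → ℤ), (∀ z ∈ E, ∑ i, |z i| ≤ (m : ℤ)) →
        Set.InjOn (fun z : X → ℤ => ∑ i, z i • g σ i) E → (E.card : ℝ) ≤ 8 / p := by
  set h : AddChar G ℂ → ι → ℝ := fun χ i => 1 - (χ (g σ i)).re with hh
  have hre : ∀ (χ : AddChar G ℂ) (x : G), |(χ x).re| ≤ 1 := fun χ x =>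
    (Complex.abs_re_le_norm _).trans (AddChar.norm_apply χ x).le
  have hh0 : ∀ χ i, 0 ≤ h χ i := fun χ i => by
    have := (abs_le.1 (hre χ (g σ i))).2
    simp only [hh]; linarith
  have hh2 : ∀ χ i, h χ i ≤ 2 := fun χ i => by
    have := (abs_le.1 (hre χ (g σ i))).1
    simp only [hh]; linarith
  have hcG : (0 : ℝ) < Fintype.card G := by exact_mod_cast Fintype.card_pos
  set S : (ι → Bool) × (ι → Bool) × (ι → Bool) → G :=
    fun t => ∑ i, bitDiff (t.2.1 i) (t.2.2 i) • g (t.1 i) i with hS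
  have hchar : ∀ χ : AddChar G ℂ,
      ‖∑ t, χ (S t)‖ ≤ 8 ^ Fintype.card ι * Real.exp (-(∑ i, h χ i) / 4) := by
    intro χ
    have : ∑ t, χ (S t) = ∏ i, ∑ s, ∑ x, ∑ x', χ (bitDiff x x' • g s i) := by
      rw [← sum_prod_three (fun i s x x' => χ (bitDiff x x' • g s i))]
      refine Finset.sum_congr rfl fun t _ => ?_
      simp only [hS]
      exact map_prod χ.toMonoidHom
        (fun i => Multiplicative.ofAdd (bitDiff (t.2.1 i) (t.2.2 i) • g (t.1 i) i)) _
    rw [this, norm_prod]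
    calc ∏ i, ‖∑ s, ∑ x, ∑ x', χ (bitDiff x x' • g s i)‖
        ≤ ∏ i, (8 * Real.exp (-(h χ i / 4))) := by
          refine Finset.prod_le_prod (fun _ _ => norm_nonneg _) fun i _ => ?_
          refine (norm_sum_addChar_bitDiff_le χ (fun s => g s i) σ).trans ?_
          gcongr
          exact Real.one_sub_le_exp_neg _
      _ = _ := by
          rw [Finset.prod_mul_distrib, Finset.prod_const, Finset.card_univ, ← Real.exp_sum,
            Finset.sum_neg_distrib, ← Finset.sum_div, neg_div]
  set Λ : Finset (AddChar G ℂ) := Finset.univ.filter fun χ => ∑ i, h χ i ≤ lam with hΛ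
  have hΛcard : p * Fintype.card G / 2 ≤ Λ.card := by
    have h1 : (p * 8 ^ Fintype.card ι) * Fintype.card G ≤ ∑ χ : AddChar G ℂ, ‖∑ t, χ (S t)‖ := by
      have e1 : ∑ χ : AddChar G ℂ, ∑ t, χ (S t) =
          (((Finset.univ.filter fun t => S t = 0).card : ℝ) * Fintype.card G : ℝ) := by
        rw [Finset.sum_comm]
        simp_rw [AddChar.sum_apply_eq_ite]
        rw [← Finset.sum_filter]
        simp
      calc (p * 8 ^ Fintype.card ι) * Fintype.card G
          ≤ ((Finset.univ.filter fun t => S t = 0).card : ℝ) * Fintype.card G := by gcongr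
        _ = ‖∑ χ : AddChar G ℂ, ∑ t, χ (S t)‖ := by
          rw [e1, Complex.norm_real, Real.norm_eq_abs, abs_of_nonneg (by positivity)]
        _ ≤ _ := norm_sum_le _ _
    have h2 : ∑ χ : AddChar G ℂ, ‖∑ t, χ (S t)‖ ≤
        ∑ χ : AddChar G ℂ, ((if χ ∈ Λ then 8 ^ Fintype.card ι else 0) +
          8 ^ Fintype.card ι * (p / 2)) := by
      refine Finset.sum_le_sum fun χ _ => (hchar χ).trans ?_
      split_ifs with hχ
      · have : Real.exp (-(∑ i, h χ i) / 4) ≤ 1 := by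
          rw [Real.exp_le_one_iff]
          have := Finset.sum_nonneg fun i (_ : i ∈ Finset.univ) => hh0 χ i
          linarith
        have h8 : (0 : ℝ) < 8 ^ Fintype.card ι := by positivity
        nlinarith
      · rw [zero_add]
        gcongr
        refine le_trans (Real.exp_le_exp.2 ?_) hlam
        simp only [hΛ, Finset.mem_filter, Finset.mem_univ, true_and, not_le] at hχ
        linarith
    rw [Finset.sum_add_distrib, ← Finset.sum_filter, Finset.sum_const, Finset.sum_const,
      Finset.card_univ, AddChar.card_eq, nsmul_eq_mul, nsmul_eq_mul] at h2
    simp only [Finset.filter_mem_eq_inter, Finset.univ_inter] at h2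
    have h8 : (0 : ℝ) < 8 ^ Fintype.card ι := by positivity
    have h3 := h1.trans h2
    have h4 : (8 : ℝ) ^ Fintype.card ι * (p * Fintype.card G / 2) ≤
        8 ^ Fintype.card ι * Λ.card := by
      linarith
    exact le_of_mul_le_mul_left h4 h8
  have hΛpos : (0 : ℝ) < Λ.card := lt_of_lt_of_le (by positivity) hΛcard
  set X : Finset ι := Finset.univ.filter fun i => ∑ χ ∈ Λ, h χ i ≤ δ * Λ.card with hX
  refine ⟨X, ?_, ?_⟩
  · have h1 : (Xᶜ.card : ℝ) * (δ * Λ.card) ≤ ∑ i ∈ Xᶜ, ∑ χ ∈ Λ, h χ i := by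
      rw [← nsmul_eq_mul, ← Finset.sum_const]
      refine Finset.sum_le_sum fun i hi => ?_
      simp only [hX, Finset.mem_compl, Finset.mem_filter, Finset.mem_univ, true_and, not_le] at hi
      exact hi.le
    have h2 : ∑ i ∈ Xᶜ, ∑ χ ∈ Λ, h χ i ≤ ∑ i, ∑ χ ∈ Λ, h χ i :=
      Finset.sum_le_sum_of_subset_of_nonneg (Finset.subset_univ _)
        fun i _ _ => Finset.sum_nonneg fun χ _ => hh0 χ i
    have h3 : ∑ i, ∑ χ ∈ Λ, h χ i ≤ Λ.card * lam := by
      rw [Finset.sum_comm, ← nsmul_eq_mul, ← Finset.sum_const]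
      exact Finset.sum_le_sum fun χ hχ => (Finset.mem_filter.1 hχ).2
    have h4 : (Λ.card : ℝ) * ((Xᶜ.card : ℝ) * δ) ≤ Λ.card * lam := by linarith
    exact le_of_mul_le_mul_left h4 hΛpos
  · intro E hE hinj
    have hbig : ∀ z ∈ E, (Λ.card : ℝ) / 2 ≤ ‖∑ χ ∈ Λ, χ (∑ i, z i • g σ i)‖ := by
      intro z hz
      have h1 : ∑ χ ∈ Λ, (1 - (χ (∑ i, z i • g σ i)).re) ≤ Λ.card / 2 := by
        calc ∑ χ ∈ Λ, (1 - (χ (∑ i, z i • g σ i)).re)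
            ≤ ∑ χ ∈ Λ, (m * ∑ i, |(z i : ℝ)| * h χ i) :=
              Finset.sum_le_sum fun χ _ => one_sub_re_sum_zsmul_le χ _ z m (hE z hz)
          _ = m * ∑ i, |(z i : ℝ)| * ∑ χ ∈ Λ, h χ i := by
              rw [← Finset.mul_sum, Finset.sum_comm]
              simp_rw [Finset.mul_sum]
          _ ≤ m * ∑ i, |(z i : ℝ)| * (δ * Λ.card) := by
              gcongr with i _
              exact (Finset.mem_filter.1 i.2).2
          _ = (m * δ * Λ.card) * ∑ i, |(z i : ℝ)| := by
              rw [← Finset.sum_mul]; ring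
          _ ≤ Λ.card / 2 := by
              have hm : ∑ i, |(z i : ℝ)| ≤ m := by exact_mod_cast hE z hz
              have hs : 0 ≤ ∑ i, |(z i : ℝ)| := Finset.sum_nonneg fun _ _ => abs_nonneg _
              rcases le_or_gt 0 δ with hd | hd
              · calc (m * δ * Λ.card) * ∑ i, |(z i : ℝ)| ≤ (m * δ * Λ.card) * m := by gcongr
                  _ = (m ^ 2 * δ) * Λ.card := by ring
                  _ ≤ 1 / 2 * Λ.card := by gcongr
                  _ = _ := by ring
              · have : (m * δ * Λ.card) ≤ 0 :=
                  mul_nonpos_of_nonpos_of_nonneg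
                    (mul_nonpos_of_nonneg_of_nonpos (by positivity) hd.le) hΛpos.le
                nlinarith
      have h2 := Complex.re_le_norm (∑ χ ∈ Λ, χ (∑ i, z i • g σ i))
      rw [Complex.re_sum] at h2
      rw [Finset.sum_sub_distrib] at h1
      simp only [Finset.sum_const, nsmul_eq_mul, mul_one] at h1
      linarith
    have h1 : (E.card : ℝ) * (Λ.card / 2) ^ 2 ≤ Fintype.card G * Λ.card := by
      rw [← sum_norm_sq_sum_addChar]
      calc (E.card : ℝ) * (Λ.card / 2) ^ 2
          = ∑ x ∈ E.image (fun z : X → ℤ => ∑ i, z i • g σ i), ((Λ.card : ℝ) / 2) ^ 2 := by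
            rw [Finset.sum_const, Finset.card_image_of_injOn hinj, nsmul_eq_mul]
        _ ≤ ∑ x ∈ E.image (fun z : X → ℤ => ∑ i, z i • g σ i), ‖∑ χ ∈ Λ, χ x‖ ^ 2 := by
            refine Finset.sum_le_sum fun x hx => ?_
            obtain ⟨z, hz, rfl⟩ := Finset.mem_image.1 hx
            have := hbig z hz
            gcongr
        _ ≤ _ := Finset.sum_le_sum_of_subset_of_nonneg (Finset.subset_univ _)
            fun _ _ _ => by positivity
    have h2 : (Λ.card : ℝ) * (E.card * Λ.card) ≤ Λ.card * (4 * Fintype.card G) := by linarith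
    have h3 := le_of_mul_le_mul_left h2 hΛpos
    rw [le_div_iff₀ hp]
    have h4 : (E.card : ℝ) * (p * Fintype.card G / 2) ≤ E.card * Λ.card := by gcongr
    have h5 : (Fintype.card G : ℝ) * (E.card * p) ≤ Fintype.card G * 8 := by linarith
    exact le_of_mul_le_mul_left h5 hcG

theorem exists_finite_model {κ : Type} [Fintype κ] (y : κ → ℝ) (M : ℕ) :
    ∃ (G : Type) (_ : AddCommGroup G) (_ : Fintype G) (g : κ → G),
      (∀ (τ : Type) [Fintype τ] (f : τ → κ) (z : τ → ℤ),
        ∑ i, (z i : ℝ) * y (f i) = 0 → ∑ i, z i • g (f i) = 0) ∧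
      ∀ (τ : Type) [Fintype τ] (f : τ → κ) (z : τ → ℤ), ∑ i, |z i| ≤ (M : ℤ) →
        ∑ i, z i • g (f i) = 0 → ∑ i, (z i : ℝ) * y (f i) = 0 := by
  set S := Submodule.span ℤ (Set.range y) with hS
  have hfin : Module.Finite ℤ S := Module.Finite.span_of_finite ℤ (Set.finite_range y)
  set b := Module.finBasis ℤ S with hb
  set v : κ → S := fun i => ⟨y i, Submodule.subset_span ⟨i, rfl⟩⟩ with hv
  set a : κ → Fin (Module.finrank ℤ S) → ℤ := fun i => b.equivFun (v i) with ha
  have key : ∀ (τ : Type) [Fintype τ] (f : τ → κ) (z : τ → ℤ),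
      ∑ i, (z i : ℝ) * y (f i) = 0 ↔ ∀ l, ∑ i, z i * a (f i) l = 0 := by
    intro τ _ f z
    have h1 : ∑ i, (z i : ℝ) * y (f i) = ((∑ i, z i • v (f i) : S) : ℝ) := by
      push_cast
      exact Finset.sum_congr rfl fun i _ => by simp [hv]
    rw [h1, Submodule.coe_eq_zero, ← b.equivFun.map_eq_zero_iff, map_sum, funext_iff]
    refine forall_congr' fun l => ?_
    simp [ha]
  set p : ℕ := M * (∑ i, ∑ l, (a i l).natAbs) + 1 with hp
  have : NeZero p := ⟨by omega⟩
  refine ⟨Fin (Module.finrank ℤ S) → ZMod p, inferInstance, inferInstance,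
    fun i l => (a i l : ZMod p), ?_, ?_⟩
  · intro τ _ f z h
    rw [key] at h
    funext l
    have := congrArg (Int.cast : ℤ → ZMod p) (h l)
    simpa using this
  · intro τ _ f z hz h
    rw [key]
    intro l
    have h1 : ((∑ i, z i * a (f i) l : ℤ) : ZMod p) = 0 := by
      have := congrFun h l
      simpa using this
    rw [ZMod.intCast_zmod_eq_zero_iff_dvd] at h1
    refine Int.eq_zero_of_abs_lt_dvd h1 ?_
    calc |∑ i, z i * a (f i) l| ≤ ∑ i, |z i * a (f i) l| := Finset.abs_sum_le_sum_abs _ _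
      _ ≤ ∑ i, |z i| * ((∑ i, ∑ l, (a i l).natAbs : ℕ) : ℤ) := by
          refine Finset.sum_le_sum fun i _ => ?_
          rw [abs_mul]
          refine mul_le_mul_of_nonneg_left ?_ (abs_nonneg _)
          rw [Int.abs_eq_natAbs]
          have h2 : (a (f i) l).natAbs ≤ ∑ l, (a (f i) l).natAbs :=
            Finset.single_le_sum (f := fun l => (a (f i) l).natAbs) (fun _ _ => Nat.zero_le _)
              (Finset.mem_univ l)
          have h3 : ∑ l, (a (f i) l).natAbs ≤ ∑ i, ∑ l, (a i l).natAbs :=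
            Finset.single_le_sum (f := fun i => ∑ l, (a i l).natAbs) (fun _ _ => Nat.zero_le _)
              (Finset.mem_univ (f i))
          exact_mod_cast h2.trans h3
      _ = (∑ i, |z i|) * ((∑ i, ∑ l, (a i l).natAbs : ℕ) : ℤ) := by rw [Finset.sum_mul]
      _ ≤ M * ((∑ i, ∑ l, (a i l).natAbs : ℕ) : ℤ) := by gcongr
      _ < p := by rw [hp]; push_cast; linarith

theorem exists_large_fewSums_subfamily {n : ℕ} (c : Bool → Fin n → ℝ) (σ : Bool) (p lam δ : ℝ)
    (m N : ℕ) (hp : 0 < p) (hlam : Real.exp (-lam / 4) ≤ p / 2) (hδ : (m : ℝ) ^ 2 * δ ≤ 1 / 2)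
    (hN : 8 / p ≤ N)
    (hcount : p * 8 ^ n ≤
      ((Finset.univ.filter fun t : (Fin n → Bool) × (Fin n → Bool) × (Fin n → Bool) =>
        ∑ i, (bitDiff (t.2.1 i) (t.2.2 i) : ℝ) * c (t.1 i) i = 0).card : ℝ)) :
    ∃ X : Finset (Fin n), (Xᶜ.card : ℝ) * δ ≤ lam ∧ FewSums (fun i : X => c σ i) m N := by
  obtain ⟨G, _, _, g, hg1, hg2⟩ := exists_finite_model
    (fun q : Bool × Fin n => c q.1 q.2) (2 * m)
  obtain ⟨X, hX1, hX2⟩ := exists_fewSums_of_concentration (fun s i => g (s, i)) σ p lam δ m hp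
    hlam hδ (by
      rw [Fintype.card_fin]
      refine hcount.trans ?_
      refine Nat.cast_le.2 (Finset.card_le_card fun t ht => ?_)
      simp only [Finset.mem_filter, Finset.mem_univ, true_and] at ht ⊢
      exact hg1 (Fin n) (fun i => (t.1 i, i)) (fun i => bitDiff (t.2.1 i) (t.2.2 i)) ht)
  refine ⟨X, by convert hX1, fun E hE hinj => ?_⟩
  have := (hX2 E hE ?_).trans hN
  · exact_mod_cast this
  intro z hz z' hz' heq
  apply hinj hz hz'
  have h1 := hg2 X (fun i => (σ, (i : Fin n))) (fun i => z i - z' i) (by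
    calc ∑ i, |z i - z' i| ≤ ∑ i, (|z i| + |z' i|) := Finset.sum_le_sum fun i _ => abs_sub _ _
      _ ≤ _ := by
        rw [Finset.sum_add_distrib]
        have := hE z hz
        have := hE z' hz'
        push_cast
        linarith) (by
      simp only at heq
      simp_rw [sub_smul, Finset.sum_sub_distrib]
      rw [heq, sub_self])
  simp only [Int.cast_sub, sub_mul, Finset.sum_sub_distrib] at h1
  exact sub_eq_zero.1 h1

open Filter in
theorem eventually_parameters (ε A : ℝ) (hε0 : 0 < ε) (hε1 : ε < 1) (hA : 0 < A) :
    ∃ R : ℕ, ∀ᶠ n : ℕ in atTop, ∃ k : ℕ, 2 ≤ k ∧ (R + 1) ^ (R + 1) < k ^ 2 ∧ R + 1 ≤ k ∧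
      k ^ (2 * R) < 2 ^ k ∧ 8 / (n : ℝ) ^ (-A) ≤ ((k ^ (2 * R) : ℕ) : ℝ) ∧ k ≤ n ∧ 2 ≤ n ∧
      8 * (A + 1) * Real.log n * (k : ℝ) ^ 4 ≤ (n : ℝ) ^ ε := by
  set R : ℕ := ⌈16 * A / ε⌉₊ + 1 with hR
  refine ⟨R, ?_⟩
  have hcast : Tendsto (fun n : ℕ => (n : ℝ)) atTop atTop := tendsto_natCast_atTop_atTop
  have hx : Tendsto (fun n : ℕ => (n : ℝ) ^ (ε / 16)) atTop atTop :=
    (tendsto_rpow_atTop (by positivity)).comp hcast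
  have hk : Tendsto (fun n : ℕ => ⌊(n : ℝ) ^ (ε / 16)⌋₊) atTop atTop :=
    tendsto_nat_floor_atTop.comp hx
  have hpow : ∀ᶠ k : ℕ in atTop, k ^ (2 * R) < 2 ^ k := by
    have h := tendsto_pow_const_div_const_pow_of_one_lt (2 * R) (r := 2) (by norm_num)
    filter_upwards [h.eventually (gt_mem_nhds one_pos)] with k hk
    rw [div_lt_one (by positivity)] at hk
    exact_mod_cast hk
  have hlog : ∀ᶠ n : ℕ in atTop, 8 * (A + 1) * Real.log n ≤ (n : ℝ) ^ (ε / 4) := by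
    have h := (isLittleO_log_rpow_atTop (r := ε / 4) (by positivity)).bound
      (c := 1 / (8 * (A + 1))) (by positivity)
    filter_upwards [hcast.eventually h, eventually_ge_atTop 1] with n hn hn1
    have h1 : (1 : ℝ) ≤ n := by exact_mod_cast hn1
    rw [Real.norm_of_nonneg (Real.log_nonneg h1), Real.norm_of_nonneg (by positivity),
      one_div_mul_eq_div, le_div_iff₀ (by positivity)] at hn
    linarith
  have hA' : ∀ᶠ n : ℕ in atTop, 8 * 2 ^ (2 * R) ≤ (n : ℝ) ^ A :=
    ((tendsto_rpow_atTop hA).comp hcast).eventually_ge_atTop _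
  filter_upwards [hk.eventually hpow, hk.eventually_ge_atTop 2,
    hk.eventually_ge_atTop ((R + 1) ^ (R + 1) + 1), hk.eventually_ge_atTop (R + 1), hlog, hA',
    eventually_ge_atTop 2, hx.eventually_ge_atTop 2] with n h1 h2 h3 h4 h5 h6 h7 h8
  set x := (n : ℝ) ^ (ε / 16) with hxdef
  set k := ⌊x⌋₊ with hkdef
  have hn1 : (1 : ℝ) ≤ n := by exact_mod_cast (by omega : 1 ≤ n)
  have hn0 : (0 : ℝ) < n := by linarith
  have hkx : (k : ℝ) ≤ x := Nat.floor_le (by positivity)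
  have hxk : x / 2 ≤ k := by
    have := Nat.lt_floor_add_one x
    rw [← hkdef] at this
    linarith
  refine ⟨k, h2, by nlinarith, h4, h1, ?_, ?_, h7, ?_⟩
  · rw [Real.rpow_neg hn0.le, div_inv_eq_mul]
    push_cast
    have e1 : x ^ (2 * R) = (n : ℝ) ^ (ε / 16 * (2 * R : ℕ)) := by
      rw [hxdef, ← Real.rpow_natCast, ← Real.rpow_mul hn0.le]
    have e2 : A + A ≤ ε / 16 * (2 * R : ℕ) := by
      have : 16 * A / ε ≤ R := by
        rw [hR]; push_cast
        linarith [Nat.le_ceil (16 * A / ε)]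
      rw [div_le_iff₀ hε0] at this
      push_cast
      linarith
    have e3 : (n : ℝ) ^ A * (n : ℝ) ^ A ≤ x ^ (2 * R) := by
      rw [e1, ← Real.rpow_add hn0]
      exact Real.rpow_le_rpow_of_exponent_le hn1 e2
    have e4 : x ^ (2 * R) ≤ 2 ^ (2 * R) * (k : ℝ) ^ (2 * R) := by
      rw [← mul_pow]
      exact pow_le_pow_left₀ (by positivity) (by linarith) _
    have e5 : (8 * 2 ^ (2 * R)) * (n : ℝ) ^ A ≤ 2 ^ (2 * R) * (k : ℝ) ^ (2 * R) :=
      (mul_le_mul_of_nonneg_right h6 (by positivity)).trans (e3.trans e4)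
    have e6 : (0 : ℝ) < 2 ^ (2 * R) := by positivity
    have e7 : (2 : ℝ) ^ (2 * R) * (8 * (n : ℝ) ^ A) ≤ 2 ^ (2 * R) * (k : ℝ) ^ (2 * R) := by
      linarith
    exact le_of_mul_le_mul_left e7 e6
  · have : (k : ℝ) ≤ n := hkx.trans (by
      conv_rhs => rw [← Real.rpow_one (n : ℝ)]
      exact Real.rpow_le_rpow_of_exponent_le hn1 (by linarith))
    exact_mod_cast this
  · calc 8 * (A + 1) * Real.log n * (k : ℝ) ^ 4 ≤ (n : ℝ) ^ (ε / 4) * x ^ 4 := by gcongr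
      _ = (n : ℝ) ^ (ε / 2) := by
        rw [hxdef, ← Real.rpow_natCast, ← Real.rpow_mul hn0.le, ← Real.rpow_add hn0]
        congr 1; push_cast; ring
      _ ≤ _ := Real.rpow_le_rpow_of_exponent_le hn1 (by linarith)

open Filter in
theorem exists_common_linear_relation (ε A : ℝ) (hε0 : 0 < ε) (hε1 : ε < 1) (hA : 0 < A) :
    ∃ r B : ℕ, ∀ᶠ n : ℕ in atTop, ∀ (c : Bool → Fin n → ℝ) (σ : Bool),
      (n : ℝ) ^ (-A) * 8 ^ n ≤
        ((Finset.univ.filter fun t : (Fin n → Bool) × (Fin n → Bool) × (Fin n → Bool) =>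
          ∑ i, (bitDiff (t.2.1 i) (t.2.2 i) : ℝ) * c (t.1 i) i = 0).card : ℝ) →
      ∃ (X : Finset (Fin n)) (w : Fin r → Fin n) (k : ℕ), (n : ℝ) - (n : ℝ) ^ ε ≤ X.card ∧
        1 ≤ k ∧ k ≤ n ^ B ∧ ∀ i ∈ X, ∃ κ : Fin r → ℤ, (∀ l, |κ l| ≤ ((n ^ B : ℕ) : ℤ)) ∧
          (k : ℝ) * c σ i = ∑ l, (κ l : ℝ) * c σ (w l) := by
  obtain ⟨R, hR⟩ := eventually_parameters ε A hε0 hε1 hA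
  refine ⟨R, scaleExponent R (R + 1), ?_⟩
  filter_upwards [hR] with n hn c σ hcount
  obtain ⟨k, hk2, hkR1, hkR2, hkR3, hkN, hkn, hn2, hlog⟩ := hn
  have hn0 : (0 : ℝ) < n := by exact_mod_cast (by omega : 0 < n)
  have hk0 : (0 : ℝ) < k := by exact_mod_cast (by omega : 0 < k)
  obtain ⟨X, hX, hfew⟩ := exists_large_fewSums_subfamily c σ ((n : ℝ) ^ (-A))
    (4 * (A + 1) * Real.log n) (1 / (2 * k ^ 4)) (k ^ 2) (k ^ (2 * R)) (by positivity) (by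
      have h1 : Real.exp (-(4 * (A + 1) * Real.log n) / 4) = (n : ℝ) ^ (-A) * (n : ℝ)⁻¹ := by
        rw [← Real.rpow_neg_one, ← Real.rpow_add hn0, Real.rpow_def_of_pos hn0]
        congr 1; ring
      rw [h1, div_eq_mul_inv]
      gcongr
      exact_mod_cast hn2) (by
      push_cast
      field_simp
      norm_num) hkN hcount
  obtain ⟨d, hd, w, D, hD1, hD2, hD3⟩ :=
    exists_commonDenominator (fun i : X => c σ i) R k hk2 hkR1 hkR2 hkR3 hfew
  have hS : k ^ scaleExponent R (R + 1) ≤ n ^ scaleExponent R (R + 1) := Nat.pow_le_pow_left hkn _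
  obtain ⟨e, rfl⟩ := Nat.exists_eq_add_of_le hd
  refine ⟨X, Fin.append (fun l => (w l : Fin n)) (fun _ => ⟨0, by omega⟩), D, ?_, hD1,
    hD2.trans hS, fun i hi => ?_⟩
  · have h1 : (Xᶜ.card : ℝ) ≤ (n : ℝ) ^ ε := by
      refine le_trans ?_ hlog
      rw [mul_one_div, div_le_iff₀ (by positivity)] at hX
      linarith
    have h2 : (Xᶜ.card : ℝ) = n - X.card := by
      rw [Finset.card_compl, Fintype.card_fin, Nat.cast_sub (by
        simpa using Finset.card_le_univ X)]
    linarith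
  · obtain ⟨κ, h1, h2⟩ := hD3 ⟨i, hi⟩
    refine ⟨Fin.append κ (fun _ => 0), fun l => ?_, ?_⟩
    · refine Fin.addCases (fun l => ?_) (fun l => ?_) l
      · rw [Fin.append_left]
        exact (h1 l).trans (by exact_mod_cast hS)
      · rw [Fin.append_right]
        simp
    · rw [Fin.sum_univ_add]
      simpa using h2

theorem IsProperSymGAPSet.mono {Q : Set ℝ} {r r' : ℕ} {s s' : ℝ} (h : IsProperSymGAPSet Q r s)
    (hr : r ≤ r') (hs : s ≤ s') : IsProperSymGAPSet Q r' s' := by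
  obtain ⟨d, g, N, h1, h2, h3, h4⟩ := h
  exact ⟨d, g, N, h1.trans hr, h2, h3, h4.trans hs⟩

theorem exists_isProperSymGAPSet (r : ℕ) (g : Fin r → ℝ) (M : ℕ) (hM : 1 ≤ M) :
    ∃ Q : Set ℝ, IsProperSymGAPSet Q r (((2 * (4 * M) ^ 2 ^ r + 1) ^ r : ℕ) : ℝ) ∧
      ∀ z : Fin r → ℤ, (∀ l, |z l| ≤ (M : ℤ)) → ∑ l, (z l : ℝ) * g l ∈ Q := by
  induction r generalizing M with
  | zero =>
    refine ⟨{0}, ⟨0, Fin.elim0, Fin.elim0, le_rfl, ?_, fun _ _ _ _ _ => Subsingleton.elim _ _, ?_⟩,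
      fun z _ => by simp⟩
    · ext x
      simp
    · simp
  | succ r ih =>
    by_cases hprop : ∀ m m' : Fin (r + 1) → ℤ, (∀ i, |m i| ≤ (M : ℤ)) →
        (∀ i, |m' i| ≤ (M : ℤ)) → (∑ i, (m i : ℝ) * g i) = (∑ i, (m' i : ℝ) * g i) → m = m'
    · refine ⟨_, ⟨r + 1, g, fun _ => M, le_rfl, rfl, hprop, ?_⟩, fun z hz => ⟨z, hz, rfl⟩⟩
      have h1 : M ≤ (4 * M) ^ 2 ^ (r + 1) :=
        (by omega : M ≤ 4 * M).trans (Nat.le_self_pow (by positivity) _)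
      have h2 : (2 * M + 1) ^ (r + 1) ≤ (2 * (4 * M) ^ 2 ^ (r + 1) + 1) ^ (r + 1) := by gcongr
      simp only [Finset.prod_const, Finset.card_univ, Fintype.card_fin]
      exact_mod_cast h2
    · push Not at hprop
      obtain ⟨m, m', hm, hm', heq, hne⟩ := hprop
      obtain ⟨p, hp⟩ := Function.ne_iff.1 hne
      set c : Fin (r + 1) → ℤ := fun i => m i - m' i with hc
      have hcp : (c p : ℝ) ≠ 0 := by
        exact_mod_cast sub_ne_zero.2 hp
      have hcM : ∀ i, |c i| ≤ 2 * (M : ℤ) := fun i => (abs_sub _ _).trans (by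
        have := hm i
        have := hm' i
        linarith)
      have hc0 : ∑ i, (c i : ℝ) * g i = 0 := by
        simp only [hc, Int.cast_sub, sub_mul, Finset.sum_sub_distrib]
        rw [heq, sub_self]
      obtain ⟨Q, hQ, hmem⟩ := ih (fun l => g (p.succAbove l) / c p) (4 * M ^ 2) (by nlinarith)
      refine ⟨Q, hQ.mono (Nat.le_succ r) ?_, fun z hz => ?_⟩
      · have e : (4 * (4 * M ^ 2)) ^ 2 ^ r = (4 * M) ^ 2 ^ (r + 1) := by
          rw [pow_succ 2 r, mul_comm (2 ^ r) 2, pow_mul]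
          congr 1; ring
        rw [e]
        exact_mod_cast Nat.pow_le_pow_right (by omega) (Nat.le_succ r)
      · have := hmem (fun l => c p * z (p.succAbove l) - c (p.succAbove l) * z p) (fun l => by
          calc |c p * z (p.succAbove l) - c (p.succAbove l) * z p|
              ≤ |c p| * |z (p.succAbove l)| + |c (p.succAbove l)| * |z p| := by
                rw [← abs_mul, ← abs_mul]; exact abs_sub _ _
            _ ≤ (2 * M) * M + (2 * M) * M := by
                gcongr
                · exact hcM _
                · exact hz _
                · exact hcM _
                · exact hz _
            _ = _ := by push_cast; ring)
        convert this using 1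
        rw [Fin.sum_univ_succAbove _ p] at hc0 ⊢
        have h1 : g p = -(∑ l, (c (p.succAbove l) : ℝ) * g (p.succAbove l)) / c p := by
          rw [eq_div_iff hcp]; linarith
        rw [h1, neg_div, mul_neg, Finset.sum_div, Finset.mul_sum, ← Finset.sum_neg_distrib,
          ← Finset.sum_add_distrib]
        refine Finset.sum_congr rfl fun l _ => ?_
        push_cast
        field_simp
        ring

theorem sum_pow_four_le {α β : Type*} [Fintype α] [Fintype β] (f : α → β → ℝ) :
    (∑ a, ∑ b, f a b) ^ 4 ≤ ((Fintype.card α : ℝ) * Fintype.card β) ^ 2 *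
      ∑ a, ∑ a', ∑ b, ∑ b', f a b * f a' b * f a b' * f a' b' := by
  set T : ℝ := ∑ a, ∑ a', ∑ b, f a b * f a' b with hT
  have h1 : (∑ a, ∑ b, f a b) ^ 2 ≤ Fintype.card β * T := by
    rw [Finset.sum_comm]
    refine sq_sum_le_card_mul_sum_sq.trans_eq ?_
    rw [Finset.card_univ, hT]
    congr 1
    simp_rw [sq, Finset.sum_mul_sum]
    rw [Finset.sum_comm]
    exact Finset.sum_congr rfl fun a _ => Finset.sum_comm
  have h2 : T ^ 2 ≤ (Fintype.card α : ℝ) ^ 2 *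
      ∑ a, ∑ a', ∑ b, ∑ b', f a b * f a' b * f a b' * f a' b' := by
    have e : T = ∑ q : α × α, ∑ b, f q.1 b * f q.2 b := by
      rw [hT, Fintype.sum_prod_type]
    rw [e]
    refine sq_sum_le_card_mul_sum_sq.trans_eq ?_
    rw [Finset.card_univ, Fintype.card_prod, Fintype.sum_prod_type]
    push_cast
    simp_rw [sq, Finset.sum_mul_sum]
    congr 1
    refine Finset.sum_congr rfl fun a _ => Finset.sum_congr rfl fun a' _ =>
      Finset.sum_congr rfl fun b _ => Finset.sum_congr rfl fun b' _ => by ring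
  calc (∑ a, ∑ b, f a b) ^ 4 = ((∑ a, ∑ b, f a b) ^ 2) ^ 2 := by ring
    _ ≤ (Fintype.card β * T) ^ 2 := by gcongr
    _ = (Fintype.card β : ℝ) ^ 2 * T ^ 2 := by ring
    _ ≤ (Fintype.card β : ℝ) ^ 2 * ((Fintype.card α : ℝ) ^ 2 *
      ∑ a, ∑ a', ∑ b, ∑ b', f a b * f a' b * f a b' * f a' b') := by gcongr
    _ = _ := by ring

/-- The vector that agrees with `x` where `s` holds and with `x'` elsewhere. -/
def splice {n : ℕ} {β : Type} (s : Fin n → Bool) (x x' : Fin n → β) : Fin n → β :=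
  fun i => if s i then x i else x' i

theorem sum_pow_four_le_splice {n : ℕ} (s : Fin n → Bool) (f : (Fin n → Bool) → ℝ) :
    (∑ x, f x) ^ 4 ≤ 4 ^ n *
      ∑ q : (Fin n → Bool) × (Fin n → Bool),
        f q.1 * f (splice s q.2 q.1) * f (splice s q.1 q.2) * f q.2 := by
  set e := Equiv.piEquivPiSubtypeProd (fun i => s i = true) (fun _ : Fin n => Bool) with he
  have h := sum_pow_four_le (fun a b => f (e.symm (a, b)))
  have e1 : ∑ a, ∑ b, f (e.symm (a, b)) = ∑ x, f x := by
    rw [← Fintype.sum_prod_type' (f := fun a b => f (e.symm (a, b)))]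
    exact Fintype.sum_equiv e.symm _ _ fun _ => rfl
  have e2 : ((Fintype.card ({i // s i = true} → Bool) : ℝ) *
      Fintype.card ({i // ¬ s i = true} → Bool)) ^ 2 = 4 ^ n := by
    rw [← Nat.cast_mul, ← Fintype.card_prod, ← Fintype.card_congr e]
    simp only [Fintype.card_pi, Fintype.card_bool, Finset.prod_const, Finset.card_univ,
      Fintype.card_fin]
    push_cast
    rw [← pow_mul, mul_comm, pow_mul]
    norm_num
  rw [e1, e2] at h
  refine h.trans_eq ?_
  congr 1
  rw [← Fintype.sum_equiv (Equiv.prodCongr e.symm e.symm)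
    (fun q => f (e.symm q.1) * f (e.symm (q.2.1, q.1.2)) * f (e.symm (q.1.1, q.2.2)) *
      f (e.symm q.2)) _ ?_]
  · simp_rw [Fintype.sum_prod_type]
    refine Finset.sum_congr rfl fun a _ => ?_
    rw [Finset.sum_comm]
  · rintro ⟨⟨a, b⟩, ⟨a', b'⟩⟩
    have h1 : ∀ (a a' : {i // s i = true} → Bool) (b b' : {i // ¬ s i = true} → Bool),
        splice s (e.symm (a, b)) (e.symm (a', b')) = e.symm (a, b') := by
      intro a a' b b'
      funext i
      by_cases hi : s i = true <;> simp [splice, he, Equiv.piEquivPiSubtypeProd, hi]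
    simp only [Equiv.prodCongr_apply, Prod.map, h1]

theorem signv_sub_signv (b b' : Bool) : signv b - signv b' = 2 * bitDiff b b' := by
  cases b <;> cases b' <;> norm_num [signv, bitDiff]

/-- The part of the bilinear form of `A` supported on pairs separated by `s`. -/
def cutForm {n : ℕ} (A : Matrix (Fin n) (Fin n) ℝ) (s : Fin n → Bool) (v w : Fin n → ℝ) : ℝ :=
  ∑ i, v i * ∑ j, if s i ≠ s j then A i j * w j else 0

theorem cutForm_bitDiff_eq_zero {n : ℕ} (A : Matrix (Fin n) (Fin n) ℝ) (a : ℝ)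
    (s x x' : Fin n → Bool)
    (h : ∀ y ∈ ({x, splice s x' x, splice s x x', x'} : Set (Fin n → Bool)),
      ∑ i, ∑ j, A i j * signv (y i) * signv (y j) = a) :
    cutForm A s (fun i => bitDiff (x i) (x' i)) (fun i => bitDiff (x i) (x' i)) = 0 := by
  have h1 := h x (by simp)
  have h2 := h (splice s x' x) (by simp)
  have h3 := h (splice s x x') (by simp)
  have h4 := h x' (by simp)
  have key : 4 * cutForm A s (fun i => bitDiff (x i) (x' i)) (fun i => bitDiff (x i) (x' i)) =
      (∑ i, ∑ j, A i j * signv (x i) * signv (x j)) -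
      (∑ i, ∑ j, A i j * signv (splice s x' x i) * signv (splice s x' x j)) -
      (∑ i, ∑ j, A i j * signv (splice s x x' i) * signv (splice s x x' j)) +
      (∑ i, ∑ j, A i j * signv (x' i) * signv (x' j)) := by
    rw [cutForm, Finset.mul_sum, ← Finset.sum_sub_distrib, ← Finset.sum_sub_distrib,
      ← Finset.sum_add_distrib]
    refine Finset.sum_congr rfl fun i _ => ?_
    rw [← mul_assoc, Finset.mul_sum, ← Finset.sum_sub_distrib, ← Finset.sum_sub_distrib,
      ← Finset.sum_add_distrib]
    refine Finset.sum_congr rfl fun j _ => ?_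
    have ei := signv_sub_signv (x i) (x' i)
    have ej := signv_sub_signv (x j) (x' j)
    have e : A i j * (2 * bitDiff (x i) (x' i)) * (2 * bitDiff (x j) (x' j)) =
        A i j * (signv (x i) - signv (x' i)) * (signv (x j) - signv (x' j)) := by rw [ei, ej]
    cases hi : s i <;> cases hj : s j <;> simp [splice, hi, hj] <;> linarith
  rw [h1, h2, h3, h4] at key
  linarith

theorem card_cutForm_diag_ge {n : ℕ} (A : Matrix (Fin n) (Fin n) ℝ) (a p : ℝ) (hp : 0 ≤ p)
    (s : Fin n → Bool)
    (h : p * 2 ^ n ≤ ((Finset.univ.filter fun x : Fin n → Bool =>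
      ∑ i, ∑ j, A i j * signv (x i) * signv (x j) = a).card : ℝ)) :
    p ^ 4 * 4 ^ n ≤ ((Finset.univ.filter fun q : (Fin n → Bool) × (Fin n → Bool) =>
      cutForm A s (fun i => bitDiff (q.1 i) (q.2 i)) (fun i => bitDiff (q.1 i) (q.2 i)) = 0).card
        : ℝ) := by
  obtain ⟨P, hP⟩ : ∃ P : (Fin n → Bool) → Prop,
      P = fun x => ∑ i, ∑ j, A i j * signv (x i) * signv (x j) = a := ⟨_, rfl⟩
  have hPa : ∀ x, P x → ∑ i, ∑ j, A i j * signv (x i) * signv (x j) = a := fun x hx => by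
    rwa [hP] at hx
  have h0 : p * 2 ^ n ≤ ((Finset.univ.filter P).card : ℝ) := by rwa [hP]
  clear hP h
  have h1 := sum_pow_four_le_splice s (fun x => if P x then (1 : ℝ) else 0)
  rw [Finset.sum_boole] at h1
  have h2 : ∑ q : (Fin n → Bool) × (Fin n → Bool), (if P q.1 then (1 : ℝ) else 0) *
      (if P (splice s q.2 q.1) then 1 else 0) * (if P (splice s q.1 q.2) then 1 else 0) *
      (if P q.2 then 1 else 0) ≤
      ((Finset.univ.filter fun q : (Fin n → Bool) × (Fin n → Bool) =>
      cutForm A s (fun i => bitDiff (q.1 i) (q.2 i)) (fun i => bitDiff (q.1 i) (q.2 i)) = 0).card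
        : ℝ) := by
    rw [← Finset.sum_boole]
    refine Finset.sum_le_sum fun q _ => ?_
    by_cases h11 : P q.1; swap
    · rw [if_neg h11, zero_mul, zero_mul, zero_mul]
      split_ifs <;> norm_num
    by_cases h12 : P (splice s q.2 q.1); swap
    · rw [if_neg h12, mul_zero, zero_mul, zero_mul]
      split_ifs <;> norm_num
    by_cases h21 : P (splice s q.1 q.2); swap
    · rw [if_neg h21, mul_zero, zero_mul]
      split_ifs <;> norm_num
    by_cases h22 : P q.2; swap
    · rw [if_neg h22, mul_zero]
      split_ifs <;> norm_num
    rw [if_pos (cutForm_bitDiff_eq_zero A a s q.1 q.2 ?_), if_pos h11, if_pos h12, if_pos h21,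
      if_pos h22]
    · norm_num
    · rintro y (rfl | rfl | rfl | rfl)
      exacts [hPa _ h11, hPa _ h12, hPa _ h21, hPa _ h22]
  have h3 : (p * 2 ^ n) ^ 4 ≤ 4 ^ n * _ :=
    (pow_le_pow_left₀ (by positivity) h0 4).trans (h1.trans
      (mul_le_mul_of_nonneg_left h2 (by positivity)))
  have h4 : (p * 2 ^ n) ^ 4 = 4 ^ n * (p ^ 4 * 4 ^ n) := by
    have : (4 : ℝ) ^ n = 2 ^ n * 2 ^ n := by rw [← mul_pow]; norm_num
    rw [this]; ring
  rw [h4] at h3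
  exact le_of_mul_le_mul_left h3 (by positivity)

theorem two_mul_cutForm {n : ℕ} (A : Matrix (Fin n) (Fin n) ℝ) (hA : A.IsSymm) (s : Fin n → Bool)
    (v w : Fin n → ℝ) :
    2 * cutForm A s v w = cutForm A s (splice s v w) (splice s v w) +
      cutForm A s (splice s w v) (splice s w v) := by
  have hexp : ∀ v w : Fin n → ℝ, cutForm A s v w =
      ∑ i, ∑ j, if s i ≠ s j then A i j * v i * w j else 0 := by
    intro v w
    simp only [cutForm, Finset.mul_sum]
    refine Finset.sum_congr rfl fun i _ => Finset.sum_congr rfl fun j _ => ?_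
    split_ifs <;> ring
  have hswap : cutForm A s v w = cutForm A s w v := by
    rw [hexp, hexp, Finset.sum_comm]
    refine Finset.sum_congr rfl fun i _ => Finset.sum_congr rfl fun j _ => ?_
    rw [hA.apply i j]
    simp only [ne_comm (a := s j)]
    split_ifs <;> ring
  have : 2 * cutForm A s v w = cutForm A s v w + cutForm A s w v := by rw [← hswap]; ring
  rw [this]
  simp only [hexp, ← Finset.sum_add_distrib]
  refine Finset.sum_congr rfl fun i _ => Finset.sum_congr rfl fun j _ => ?_
  cases hi : s i <;> cases hj : s j <;> simp [splice, hi, hj] <;> ring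

theorem card_cutForm_ge {n : ℕ} (A : Matrix (Fin n) (Fin n) ℝ) (hA : A.IsSymm) (a p : ℝ)
    (hp : 0 ≤ p) (s : Fin n → Bool)
    (h : p * 2 ^ n ≤ ((Finset.univ.filter fun x : Fin n → Bool =>
      ∑ i, ∑ j, A i j * signv (x i) * signv (x j) = a).card : ℝ)) :
    p ^ 8 * 16 ^ n ≤ ((Finset.univ.filter fun q :
        ((Fin n → Bool) × (Fin n → Bool)) × ((Fin n → Bool) × (Fin n → Bool)) =>
      cutForm A s (fun i => bitDiff (q.2.1 i) (q.2.2 i)) (fun i => bitDiff (q.1.1 i) (q.1.2 i))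
        = 0).card : ℝ) := by
  set F := Finset.univ.filter fun q : (Fin n → Bool) × (Fin n → Bool) =>
      cutForm A s (fun i => bitDiff (q.1 i) (q.2 i)) (fun i => bitDiff (q.1 i) (q.2 i)) = 0 with hF
  have h1 : p ^ 4 * 4 ^ n ≤ (F.card : ℝ) := card_cutForm_diag_ge A a p hp s h
  set e : ((Fin n → Bool) × (Fin n → Bool)) × ((Fin n → Bool) × (Fin n → Bool)) →
      ((Fin n → Bool) × (Fin n → Bool)) × ((Fin n → Bool) × (Fin n → Bool)) := fun q =>
    ((splice s q.1.1 q.2.1, splice s q.1.2 q.2.2), (splice s q.2.1 q.1.1, splice s q.2.2 q.1.2))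
    with he
  have hinv : Function.Involutive e := by
    rintro ⟨⟨x, x'⟩, ⟨z, z'⟩⟩
    have : ∀ x z : Fin n → Bool, splice s (splice s x z) (splice s z x) = x := by
      intro x z
      funext i
      by_cases hi : s i <;> simp [splice, hi]
    simp only [he, this]
  have h2 : ((F ×ˢ F).image e).card = F.card * F.card := by
    rw [Finset.card_image_of_injective _ hinv.injective, Finset.card_product]
  have h3 : (F ×ˢ F).image e ⊆ Finset.univ.filter fun q :
        ((Fin n → Bool) × (Fin n → Bool)) × ((Fin n → Bool) × (Fin n → Bool)) =>
      cutForm A s (fun i => bitDiff (q.2.1 i) (q.2.2 i)) (fun i => bitDiff (q.1.1 i) (q.1.2 i))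
        = 0 := by
    intro q hq
    obtain ⟨q', hq', rfl⟩ := Finset.mem_image.1 hq
    obtain ⟨q, rfl⟩ := hinv.surjective q'
    rw [hinv q]
    simp only [hF, Finset.mem_product, Finset.mem_filter, Finset.mem_univ, true_and] at hq' ⊢
    have hsp : ∀ x x' z z' : Fin n → Bool,
        splice s (fun i => (bitDiff (x i) (x' i) : ℝ)) (fun i => (bitDiff (z i) (z' i) : ℝ)) =
        fun i => (bitDiff (splice s x z i) (splice s x' z' i) : ℝ) := by
      intro x x' z z'
      funext i
      by_cases hi : s i <;> simp [splice, hi]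
    have := two_mul_cutForm A hA s (fun i => (bitDiff (q.2.1 i) (q.2.2 i) : ℝ))
      (fun i => (bitDiff (q.1.1 i) (q.1.2 i) : ℝ))
    rw [hsp, hsp] at this
    simp only [he] at hq'
    rw [hq'.1, hq'.2] at this
    linarith
  have h4 := Finset.card_le_card h3
  rw [h2] at h4
  calc p ^ 8 * 16 ^ n = (p ^ 4 * 4 ^ n) * (p ^ 4 * 4 ^ n) := by
        have : (16 : ℝ) ^ n = 4 ^ n * 4 ^ n := by rw [← mul_pow]; norm_num
        rw [this]; ring
    _ ≤ (F.card : ℝ) * F.card := by gcongr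
    _ ≤ _ := by exact_mod_cast h4

theorem card_filter_fiber_ge {α β : Type*} [Fintype α] [Fintype β] [Nonempty β]
    (R : α → β → Prop) (δ : ℝ)
    (h : 2 * δ * (Fintype.card α * Fintype.card β) ≤
      ((Finset.univ.filter fun t : α × β => R t.1 t.2).card : ℝ)) :
    δ * Fintype.card α ≤ ((Finset.univ.filter fun a : α =>
      δ * Fintype.card β ≤ ((Finset.univ.filter fun b => R a b).card : ℝ)).card : ℝ) := by
  have hβ : (0 : ℝ) < Fintype.card β := by exact_mod_cast Fintype.card_pos
  by_cases hδ : 0 ≤ δ; swap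
  · have : δ * Fintype.card α ≤ 0 :=
      mul_nonpos_of_nonpos_of_nonneg (not_le.1 hδ).le (Nat.cast_nonneg _)
    exact this.trans (Nat.cast_nonneg _)
  have e : ((Finset.univ.filter fun t : α × β => R t.1 t.2).card : ℝ) =
      ∑ a, ((Finset.univ.filter fun b => R a b).card : ℝ) := by
    rw [← Finset.sum_boole, Fintype.sum_prod_type]
    exact Finset.sum_congr rfl fun a _ => Finset.sum_boole _ _
  rw [e] at h
  have h1 : ∑ a, ((Finset.univ.filter fun b => R a b).card : ℝ) ≤
      ∑ a : α, ((if δ * Fintype.card β ≤ ((Finset.univ.filter fun b => R a b).card : ℝ)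
        then 1 else 0) * (Fintype.card β : ℝ) + δ * Fintype.card β) := by
    refine Finset.sum_le_sum fun a _ => ?_
    have hle : ((Finset.univ.filter fun b => R a b).card : ℝ) ≤ Fintype.card β := by
      exact_mod_cast Finset.card_le_univ _
    split_ifs with hc
    · nlinarith
    · linarith
  rw [Finset.sum_add_distrib, ← Finset.sum_mul, Finset.sum_boole, Finset.sum_const,
    Finset.card_univ, nsmul_eq_mul] at h1
  refine le_of_mul_le_mul_right (a := (Fintype.card β : ℝ)) ?_ hβ
  linarith

theorem exists_card_le_mul_card_fiber {α β : Type*} [DecidableEq β] (S : Finset α) (T : Finset β)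
    (f : α → β) (hf : ∀ a ∈ S, f a ∈ T) (hT : T.Nonempty) :
    ∃ b ∈ T, S.card ≤ T.card * (S.filter fun a => f a = b).card := by
  by_contra! hcon
  have h1 := Finset.card_eq_sum_card_fiberwise hf
  have h2 : T.card * S.card = ∑ b ∈ T, T.card * (S.filter fun a => f a = b).card := by
    rw [← Finset.mul_sum, ← h1]
  have h3 : ∑ b ∈ T, T.card * (S.filter fun a => f a = b).card < ∑ b ∈ T, S.card :=
    Finset.sum_lt_sum_of_nonempty hT hcon
  rw [← h2, Finset.sum_const, smul_eq_mul] at h3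
  exact lt_irrefl _ h3

theorem card_frequently_covered_ge {α ι : Type*} [Fintype ι] [DecidableEq ι] (G : Finset α)
    (hG : G.Nonempty) (X : α → Finset ι) (δ : ℝ) (hX : ∀ a ∈ G, (Fintype.card ι : ℝ) - δ ≤ (X a).card) :
    (Fintype.card ι : ℝ) - 2 * δ ≤ ((Finset.univ.filter fun i : ι =>
      G.card ≤ 2 * (G.filter fun a => i ∈ X a).card).card : ℝ) := by
  set I := Finset.univ.filter fun i : ι => G.card ≤ 2 * (G.filter fun a => i ∈ X a).card with hI
  have hGpos : (0 : ℝ) < G.card := by exact_mod_cast hG.card_pos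
  have h1 : ∑ i, ((G.filter fun a => i ∈ X a).card : ℝ) = ∑ a ∈ G, ((X a).card : ℝ) := by
    simp_rw [← Finset.sum_boole]
    rw [Finset.sum_comm]
    refine Finset.sum_congr rfl fun a _ => ?_
    rw [Finset.sum_boole, Finset.filter_univ_mem]
  have h2 : (G.card : ℝ) * (Fintype.card ι - δ) ≤ ∑ a ∈ G, ((X a).card : ℝ) := by
    rw [← nsmul_eq_mul]
    exact Finset.card_nsmul_le_sum _ _ _ hX
  have h3 : ∑ i, ((G.filter fun a => i ∈ X a).card : ℝ) ≤
      ∑ i, ((if G.card ≤ 2 * (G.filter fun a => i ∈ X a).card then 1 else 0) *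
        ((G.card : ℝ) / 2) + (G.card : ℝ) / 2) := by
    refine Finset.sum_le_sum fun i _ => ?_
    split_ifs with hc
    · have : ((G.filter fun a => i ∈ X a).card : ℝ) ≤ G.card := by
        exact_mod_cast Finset.card_filter_le _ _
      linarith
    · have : 2 * ((G.filter fun a => i ∈ X a).card : ℝ) ≤ G.card := by
        exact_mod_cast (not_le.1 hc).le
      linarith
  rw [Finset.sum_add_distrib, ← Finset.sum_mul, Finset.sum_boole, Finset.sum_const,
    Finset.card_univ, nsmul_eq_mul, ← hI] at h3
  refine le_of_mul_le_mul_left (a := (G.card : ℝ)) ?_ hGpos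
  linarith

open Filter in
theorem exists_common_relation_of_family (ε A : ℝ) (hε0 : 0 < ε) (hε1 : ε < 1) (hA : 0 < A) :
    ∃ r B D : ℕ, ∀ᶠ n : ℕ in atTop, ∀ {α : Type} (S : Finset α) (y : α → Fin n → ℝ), S.Nonempty →
      (∀ a ∈ S, (n : ℝ) ^ (-A) * 4 ^ n ≤
        ((Finset.univ.filter fun t : (Fin n → Bool) × (Fin n → Bool) =>
          ∑ i, (bitDiff (t.1 i) (t.2 i) : ℝ) * y a i = 0).card : ℝ)) →
      ∃ (I : Finset (Fin n)) (w : Fin r → Fin n) (k : ℕ),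
        (n : ℝ) - 2 * (n : ℝ) ^ ε ≤ I.card ∧ 1 ≤ k ∧ k ≤ n ^ B ∧
        ∀ i ∈ I, ∃ κ : Fin r → ℤ, (∀ l, |κ l| ≤ ((n ^ B : ℕ) : ℤ)) ∧
          S.card ≤ n ^ D *
            (S.filter fun a => (k : ℝ) * y a i = ∑ l, (κ l : ℝ) * y a (w l)).card := by
  obtain ⟨r, B, hev⟩ := exists_common_linear_relation ε A hε0 hε1 hA
  refine ⟨r, B, (r + B + 1) + (1 + (B + 2) * r), ?_⟩
  filter_upwards [hev, eventually_ge_atTop 2] with n hn hn2 α S y hS hy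
  have hrel : ∀ a ∈ S, ∃ (X : Finset (Fin n)) (w : Fin r → Fin n) (k : ℕ),
      (n : ℝ) - (n : ℝ) ^ ε ≤ X.card ∧ 1 ≤ k ∧ k ≤ n ^ B ∧ ∀ i ∈ X, ∃ κ : Fin r → ℤ,
        (∀ l, |κ l| ≤ ((n ^ B : ℕ) : ℤ)) ∧ (k : ℝ) * y a i = ∑ l, (κ l : ℝ) * y a (w l) := by
    intro a ha
    refine hn (fun _ => y a) true ?_
    have e : (Finset.univ.filter fun t : (Fin n → Bool) × (Fin n → Bool) × (Fin n → Bool) =>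
          ∑ i, (bitDiff (t.2.1 i) (t.2.2 i) : ℝ) * y a i = 0) =
        Finset.univ ×ˢ (Finset.univ.filter fun t : (Fin n → Bool) × (Fin n → Bool) =>
          ∑ i, (bitDiff (t.1 i) (t.2 i) : ℝ) * y a i = 0) := by
      ext t
      simp
    rw [e, Finset.card_product, Finset.card_univ, Fintype.card_fun, Fintype.card_bool,
      Fintype.card_fin]
    push_cast
    calc (n : ℝ) ^ (-A) * 8 ^ n = 2 ^ n * ((n : ℝ) ^ (-A) * 4 ^ n) := by
          rw [show (8 : ℝ) = 2 * 4 by norm_num, mul_pow]; ring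
      _ ≤ _ := mul_le_mul_of_nonneg_left (hy a ha) (by positivity)
  obtain ⟨a₀, ha₀⟩ := hS
  have : NeZero n := ⟨by omega⟩
  choose! X w k hX hk1 hkB hκ using hrel
  obtain ⟨⟨w₀, k₀⟩, hT, hpig⟩ := exists_card_le_mul_card_fiber S
    ((Finset.univ : Finset (Fin r → Fin n)) ×ˢ Finset.range (n ^ B + 1)) (fun a => (w a, k a))
    (fun a ha => by simpa [Nat.lt_succ_iff] using hkB a ha)
    ⟨(w a₀, k a₀), by simpa [Nat.lt_succ_iff] using hkB a₀ ha₀⟩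
  set G := S.filter fun a => (w a, k a) = (w₀, k₀) with hG
  have hGS : ∀ a ∈ G, a ∈ S ∧ w a = w₀ ∧ k a = k₀ := by
    intro a ha
    simpa [hG] using ha
  have hGne : G.Nonempty := by
    rw [← Finset.card_pos]
    refine Nat.pos_of_ne_zero fun h0 => ?_
    rw [hG] at h0
    rw [h0, mul_zero] at hpig
    exact absurd (Finset.card_pos.2 ⟨a₀, ha₀⟩) (by omega)
  have hBpos : 1 ≤ n ^ B := Nat.one_le_pow _ _ (by omega)
  have hcard1 : ((Finset.univ : Finset (Fin r → Fin n)) ×ˢ Finset.range (n ^ B + 1)).card ≤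
      n ^ (r + B + 1) := by
    rw [Finset.card_product, Finset.card_univ, Fintype.card_fun, Fintype.card_fin,
      Fintype.card_fin, Finset.card_range, add_assoc, pow_add, pow_succ]
    gcongr
    nlinarith
  obtain ⟨a₁, ha₁⟩ := hGne
  refine ⟨Finset.univ.filter fun i => G.card ≤ 2 * (G.filter fun a => i ∈ X a).card, w₀, k₀,
    ?_, ?_, ?_, fun i hi => ?_⟩
  · simpa using card_frequently_covered_ge G ⟨a₁, ha₁⟩ X ((n : ℝ) ^ ε)
      (fun a ha => by simpa using hX a (hGS a ha).1)
  · rw [← (hGS a₁ ha₁).2.2]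
    exact hk1 a₁ (hGS a₁ ha₁).1
  · rw [← (hGS a₁ ha₁).2.2]
    exact hkB a₁ (hGS a₁ ha₁).1
  · have hi2 := (Finset.mem_filter.1 hi).2
    have hκ' : ∀ a ∈ G.filter fun a => i ∈ X a, ∃ κ : Fin r → ℤ,
        (∀ l, |κ l| ≤ ((n ^ B : ℕ) : ℤ)) ∧ (k₀ : ℝ) * y a i = ∑ l, (κ l : ℝ) * y a (w₀ l) := by
      intro a ha
      obtain ⟨haG, haX⟩ := Finset.mem_filter.1 ha
      obtain ⟨haS, hw, hk⟩ := hGS a haG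
      rw [← hw, ← hk]
      exact hκ a haS i haX
    choose! κ hκB hκeq using hκ'
    obtain ⟨κ₀, hκ₀, hpig2⟩ := exists_card_le_mul_card_fiber (G.filter fun a => i ∈ X a)
      (Fintype.piFinset fun _ : Fin r => Finset.Icc (-((n ^ B : ℕ) : ℤ)) ((n ^ B : ℕ) : ℤ)) κ
      (fun a ha => by
        rw [Fintype.mem_piFinset]
        exact fun l => Finset.mem_Icc.2 (abs_le.1 (hκB a ha l)))
      ⟨0, by
        rw [Fintype.mem_piFinset]
        exact fun l => Finset.mem_Icc.2 ⟨by simp, by simp⟩⟩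
    have hcard2 : (Fintype.piFinset fun _ : Fin r =>
        Finset.Icc (-((n ^ B : ℕ) : ℤ)) ((n ^ B : ℕ) : ℤ)).card ≤ n ^ ((B + 2) * r) := by
      rw [Fintype.card_piFinset]
      simp only [Int.card_Icc, Finset.prod_const, Finset.card_univ, Fintype.card_fin]
      rw [pow_mul]
      gcongr
      have : (((n ^ B : ℕ) : ℤ) + 1 - -((n ^ B : ℕ) : ℤ)).toNat = 2 * n ^ B + 1 := by omega
      rw [this, pow_add]
      nlinarith [Nat.mul_le_mul hn2 hn2]
    rw [Fintype.mem_piFinset] at hκ₀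
    refine ⟨κ₀, fun l => abs_le.2 (Finset.mem_Icc.1 (hκ₀ l)), ?_⟩
    have hsub : ((G.filter fun a => i ∈ X a).filter fun a => κ a = κ₀) ⊆
        S.filter fun a => (k₀ : ℝ) * y a i = ∑ l, (κ₀ l : ℝ) * y a (w₀ l) := by
      intro a ha
      obtain ⟨ha1, rfl⟩ := Finset.mem_filter.1 ha
      exact Finset.mem_filter.2 ⟨(hGS a (Finset.mem_filter.1 ha1).1).1, hκeq a ha1⟩
    calc S.card ≤ n ^ (r + B + 1) * G.card := hpig.trans (Nat.mul_le_mul_right _ hcard1)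
      _ ≤ n ^ (r + B + 1) * (n * (n ^ ((B + 2) * r) *
          (S.filter fun a => (k₀ : ℝ) * y a i = ∑ l, (κ₀ l : ℝ) * y a (w₀ l)).card)) := by
        refine Nat.mul_le_mul_left _ (hi2.trans (Nat.mul_le_mul hn2 (hpig2.trans ?_)))
        exact Nat.mul_le_mul hcard2 (Finset.card_le_card hsub)
      _ = _ := by ring

/-- The coefficient vector of the linear form `v ↦ cutForm A s v (bitDiff z z')`, where
`W = (s, z, z')`. -/
def cutRow {n : ℕ} (A : Matrix (Fin n) (Fin n) ℝ)
    (W : (Fin n → Bool) × (Fin n → Bool) × (Fin n → Bool)) (i : Fin n) : ℝ :=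
  ∑ j, if W.1 i ≠ W.1 j then A i j * (bitDiff (W.2.1 j) (W.2.2 j) : ℝ) else 0

/-- The combination of rows of `A` that a relation between the entries of `cutRow` induces on
the columns `j` with sign `b`, when the rows involved have signs `σ` and `τ`. -/
def signedRow {n r : ℕ} (A : Matrix (Fin n) (Fin n) ℝ) (i : Fin n) (w : Fin r → Fin n) (k : ℕ)
    (κ : Fin r → ℤ) (σ : Bool) (τ : Fin r → Bool) (b : Bool) (j : Fin n) : ℝ :=
  (if σ ≠ b then (k : ℝ) * A i j else 0) - ∑ l, if τ l ≠ b then (κ l : ℝ) * A (w l) j else 0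

theorem exists_signs_of_cutRow_relation {n r : ℕ} (A : Matrix (Fin n) (Fin n) ℝ) (i : Fin n)
    (w : Fin r → Fin n) (k : ℕ) (κ : Fin r → ℤ)
    (F : Finset ((Fin n → Bool) × (Fin n → Bool) × (Fin n → Bool)))
    (hF : ∀ W ∈ F, (k : ℝ) * cutRow A W i = ∑ l, (κ l : ℝ) * cutRow A W (w l)) :
    ∃ (σ : Bool) (τ : Fin r → Bool), F.card ≤ 2 ^ (r + 1) *
      (Finset.univ.filter fun t : (Fin n → Bool) × (Fin n → Bool) × (Fin n → Bool) =>
        ∑ j, (bitDiff (t.2.1 j) (t.2.2 j) : ℝ) * signedRow A i w k κ σ τ (t.1 j) j = 0).card := by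
  obtain ⟨⟨σ, τ⟩, -, h⟩ := exists_card_le_mul_card_fiber F
    (Finset.univ : Finset (Bool × (Fin r → Bool))) (fun W => (W.1 i, fun l => W.1 (w l)))
    (fun _ _ => Finset.mem_univ _) Finset.univ_nonempty
  refine ⟨σ, τ, h.trans ?_⟩
  refine Nat.mul_le_mul (by simp [pow_succ, mul_comm]) (Finset.card_le_card fun W hW => ?_)
  obtain ⟨hWF, hW⟩ := Finset.mem_filter.1 hW
  obtain ⟨rfl, rfl⟩ := Prod.mk.inj hW
  refine Finset.mem_filter.2 ⟨Finset.mem_univ _, ?_⟩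
  rw [← sub_eq_zero.2 (hF W hWF)]
  simp only [signedRow, cutRow, mul_sub, Finset.sum_sub_distrib, Finset.mul_sum]
  congr 1
  · refine Finset.sum_congr rfl fun j _ => ?_
    split_ifs <;> ring
  · rw [Finset.sum_comm]
    refine Finset.sum_congr rfl fun l _ => Finset.sum_congr rfl fun j _ => ?_
    split_ifs <;> ring

theorem card_concentrated_cutRow_ge {n : ℕ} (A : Matrix (Fin n) (Fin n) ℝ) (hA : A.IsSymm)
    (a p : ℝ) (hp : 0 ≤ p)
    (h : p * 2 ^ n ≤ ((Finset.univ.filter fun x : Fin n → Bool =>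
      ∑ i, ∑ j, A i j * signv (x i) * signv (x j) = a).card : ℝ)) :
    p ^ 8 / 2 * 8 ^ n ≤ ((Finset.univ.filter fun
      W : (Fin n → Bool) × (Fin n → Bool) × (Fin n → Bool) =>
        p ^ 8 / 2 * 4 ^ n ≤ ((Finset.univ.filter fun t : (Fin n → Bool) × (Fin n → Bool) =>
          ∑ i, (bitDiff (t.1 i) (t.2 i) : ℝ) * cutRow A W i = 0).card : ℝ)).card : ℝ) := by
  have e4 : (2 : ℝ) ^ n * 2 ^ n = 4 ^ n := by rw [← mul_pow]; norm_num
  have e24 : (2 : ℝ) ^ n * 4 ^ n = 8 ^ n := by rw [← mul_pow]; norm_num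
  have e32 : (8 : ℝ) ^ n * 4 ^ n = 2 ^ n * 16 ^ n := by rw [← mul_pow, ← mul_pow]; norm_num
  have key := card_filter_fiber_ge
    (fun (W : (Fin n → Bool) × (Fin n → Bool) × (Fin n → Bool))
      (t : (Fin n → Bool) × (Fin n → Bool)) =>
      ∑ i, (bitDiff (t.1 i) (t.2 i) : ℝ) * cutRow A W i = 0) (p ^ 8 / 2) ?_
  · simpa [e4, e24] using key
  · simp only [Fintype.card_prod, Fintype.card_fun, Fintype.card_bool, Fintype.card_fin]
    push_cast
    rw [e4, e24, e32, ← Finset.sum_boole, Fintype.sum_prod_type,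
      Fintype.sum_prod_type]
    have hs : ∀ s : Fin n → Bool, p ^ 8 * 16 ^ n ≤
        ∑ z : (Fin n → Bool) × (Fin n → Bool), ∑ t : (Fin n → Bool) × (Fin n → Bool),
          if ∑ i, (bitDiff (t.1 i) (t.2 i) : ℝ) * cutRow A (s, z) i = 0 then (1 : ℝ) else 0 := by
      intro s
      have := card_cutForm_ge A hA a p hp s h
      rwa [← Finset.sum_boole, Fintype.sum_prod_type] at this
    calc 2 * (p ^ 8 / 2) * (2 ^ n * 16 ^ n) =
          ∑ _s : Fin n → Bool, p ^ 8 * 16 ^ n := by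
          simp; ring
      _ ≤ _ := Finset.sum_le_sum fun s _ => hs s

theorem exists_level_of_lt_rhoQ {n : ℕ} (A : Matrix (Fin n) (Fin n) ℝ) (p : ℝ)
    (h : p < rhoQ n A) : ∃ a : ℝ, p * 2 ^ n ≤ ((Finset.univ.filter fun x : Fin n → Bool =>
      ∑ i, ∑ j, A i j * signv (x i) * signv (x j) = a).card : ℝ) := by
  obtain ⟨a, ha⟩ := exists_lt_of_lt_ciSup h
  exact ⟨a, ((lt_div_iff₀ (by positivity)).1 ha).le⟩

theorem exists_row_combination {n r : ℕ} (A : Matrix (Fin n) (Fin n) ℝ) (i : Fin n)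
    (w : Fin r → Fin n) (k : ℕ) (κ : Fin r → ℤ) (σ : Bool) (τ : Fin r → Bool) (M : ℕ)
    (hκ : ∀ l, |κ l| ≤ (M : ℤ)) :
    ∃ kk : Fin n → ℤ, (∀ i₀, |kk i₀| ≤ ((r * M : ℕ) : ℤ)) ∧ ∀ j,
      (k : ℝ) * A i j + ∑ i₀ ∈ Finset.univ.image w, (kk i₀ : ℝ) * A i₀ j =
        signedRow A i w k κ σ τ (!σ) j := by
  refine ⟨fun i₀ => -∑ l, if w l = i₀ then (if τ l ≠ !σ then κ l else 0) else 0,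
    fun i₀ => ?_, fun j => ?_⟩
  · rw [abs_neg]
    refine (Finset.abs_sum_le_sum_abs _ _).trans ?_
    refine (Finset.sum_le_card_nsmul _ _ (M : ℤ) fun l _ => ?_).trans (by simp)
    split_ifs
    · exact hκ l
    · simp
    · simp
  · rw [signedRow, if_pos (by cases σ <;> simp), sub_eq_add_neg]
    congr 1
    push_cast
    simp only [neg_mul, Finset.sum_neg_distrib, Finset.sum_mul]
    rw [Finset.sum_comm]
    congr 1
    refine Finset.sum_congr rfl fun l _ => ?_
    rw [Finset.sum_eq_single (w l)]
    · rw [if_pos rfl]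
      split_ifs <;> simp
    · intro b _ hb
      rw [if_neg (Ne.symm hb), zero_mul]
    · intro hl
      exact absurd (Finset.mem_image_of_mem w (Finset.mem_univ l)) hl

theorem properGAP_size_le_pow (n r B : ℕ) (hn : 2 ≤ n) :
    (2 * (4 * n ^ B) ^ 2 ^ r + 1) ^ r ≤ n ^ ((2 + (B + 2) * 2 ^ r) * r) := by
  rw [pow_mul]
  gcongr
  have h1 : 4 * n ^ B ≤ n ^ (B + 2) := by
    rw [pow_add, mul_comm]
    gcongr
    nlinarith
  have h2 : (4 * n ^ B) ^ 2 ^ r ≤ n ^ ((B + 2) * 2 ^ r) := by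
    rw [pow_mul]
    gcongr
  have h3 : 1 ≤ n ^ ((B + 2) * 2 ^ r) := Nat.one_le_pow _ _ (by omega)
  rw [pow_add]
  nlinarith [Nat.mul_le_mul hn hn]

theorem rpow_neg_add_natCast_mul_le {n a b : ℕ} (A x : ℝ) (hn : 0 < n) (D : ℕ)
    (h : (n : ℝ) ^ (-A) * x ≤ a) (hab : a ≤ n ^ D * b) :
    (n : ℝ) ^ (-(A + D)) * x ≤ b := by
  have hn' : (0 : ℝ) < n := by exact_mod_cast hn
  have hcast : (a : ℝ) ≤ (n : ℝ) ^ D * b := by exact_mod_cast hab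
  rw [neg_add, Real.rpow_add hn', Real.rpow_neg hn'.le (D : ℝ), Real.rpow_natCast]
  rw [mul_right_comm, ← div_eq_mul_inv, div_le_iff₀ (by positivity), mul_comm (b : ℝ)]
  exact h.trans hcast

/-- Refined row relation for quadratic forms. -/
theorem refined_row_relation_quadratic (ε C : ℝ) (hε0 : 0 < ε) (hε1 : ε < 1) (hC : 0 < C) :
    ∃ r₀ : ℕ, ∃ c : ℝ, 0 < c ∧ ∃ n₀ : ℕ, ∀ n : ℕ, n₀ ≤ n →
      ∀ A : Matrix (Fin n) (Fin n) ℝ, A.IsSymm → (n : ℝ) ^ (-C) ≤ rhoQ n A →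
        ∃ (I₀ I : Finset (Fin n)) (k : ℤ),
          I₀.card ≤ r₀ ∧
          (n : ℝ) - 2 * (n : ℝ) ^ ε ≤ (I.card : ℝ) ∧
          k ≠ 0 ∧ |(k : ℝ)| ≤ (n : ℝ) ^ c ∧
          ∀ i ∈ I, ∃ (kk : Fin n → ℤ) (J : Finset (Fin n)) (Q : Set ℝ),
            (∀ i₀ ∈ I₀, |(kk i₀ : ℝ)| ≤ (n : ℝ) ^ c) ∧
            (n : ℝ) - (n : ℝ) ^ ε ≤ (J.card : ℝ) ∧
            IsProperSymGAPSet Q r₀ ((n : ℝ) ^ c) ∧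
            ∀ j ∈ J, ((k : ℝ) * A i j + ∑ i₀ ∈ I₀, (kk i₀ : ℝ) * A i₀ j) ∈ Q := by
  obtain ⟨r, B, D, hev⟩ := exists_common_relation_of_family ε (8 * C + 9) hε0 hε1 (by positivity)
  obtain ⟨r', B', hev'⟩ := exists_common_linear_relation ε
    (8 * C + 9 + D + (r + 1 : ℕ)) hε0 hε1 (by positivity)
  set E : ℕ := B + r + (2 + (B' + 2) * 2 ^ r') * r' + 1 with hE
  obtain ⟨n₀, hn₀⟩ := Filter.eventually_atTop.1
    (hev.and (hev'.and (Filter.eventually_ge_atTop 2)))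
  refine ⟨r + r', (E : ℝ), by positivity, n₀, fun n hn A hA hρ => ?_⟩
  obtain ⟨hrel, hrel', hn2⟩ := hn₀ n hn
  have hn0 : 0 < n := by omega
  have hnR : (2 : ℝ) ≤ n := by exact_mod_cast hn2
  have hnpos : (0 : ℝ) < n := by positivity
  have hpow : ∀ e : ℕ, e ≤ E → n ^ e ≤ n ^ E := fun e he => Nat.pow_le_pow_right hn0 he
  obtain ⟨a, ha⟩ := exists_level_of_lt_rhoQ A ((n : ℝ) ^ (-(C + 1)))
    ((Real.rpow_lt_rpow_of_exponent_lt (by linarith) (by linarith)).trans_le hρ)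
  have hcount := card_concentrated_cutRow_ge A hA a _ (by positivity) ha
  have hp8 : (n : ℝ) ^ (-(8 * C + 9)) ≤ ((n : ℝ) ^ (-(C + 1))) ^ 8 / 2 := by
    rw [← Real.rpow_natCast, ← Real.rpow_mul hnpos.le,
      show -(8 * C + 9) = -(C + 1) * ((8 : ℕ) : ℝ) + -1 by push_cast; ring,
      Real.rpow_add hnpos, Real.rpow_neg_one, div_eq_mul_inv]
    gcongr
  set S := Finset.univ.filter fun W : (Fin n → Bool) × (Fin n → Bool) × (Fin n → Bool) =>
    ((n : ℝ) ^ (-(C + 1))) ^ 8 / 2 * 4 ^ n ≤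
      ((Finset.univ.filter fun t : (Fin n → Bool) × (Fin n → Bool) =>
        ∑ i, (bitDiff (t.1 i) (t.2 i) : ℝ) * cutRow A W i = 0).card : ℝ) with hS
  have hScard : (n : ℝ) ^ (-(8 * C + 9)) * 8 ^ n ≤ S.card :=
    (mul_le_mul_of_nonneg_right hp8 (by positivity)).trans hcount
  have hSne : S.Nonempty := by
    rw [← Finset.card_pos]
    have : (0 : ℝ) < S.card := lt_of_lt_of_le (by positivity) hScard
    exact_mod_cast this
  obtain ⟨I, w, k, hI, hk1, hkB, hκ⟩ := hrel S (cutRow A) hSne fun W hW =>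
    (mul_le_mul_of_nonneg_right hp8 (by positivity)).trans (Finset.mem_filter.1 hW).2
  refine ⟨Finset.univ.image w, I, (k : ℤ), ?_, hI, by exact_mod_cast (by omega : k ≠ 0), ?_,
    fun i hi => ?_⟩
  · exact Finset.card_image_le.trans (by simp)
  · rw [Real.rpow_natCast, Int.cast_natCast, Nat.abs_cast]
    exact_mod_cast hkB.trans (hpow B (by omega))
  · obtain ⟨κ, hκB, hfiber⟩ := hκ i hi
    obtain ⟨σ, τ, hsigns⟩ := exists_signs_of_cutRow_relation A i w k κ _
      (fun W hW => (Finset.mem_filter.1 hW).2)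
    have hsigns' := hsigns.trans (Nat.mul_le_mul_right _ (Nat.pow_le_pow_left hn2 (r + 1)))
    obtain ⟨J, w', k', hJ, hk1', -, hκ'⟩ := hrel' (signedRow A i w k κ σ τ) (!σ)
      (rpow_neg_add_natCast_mul_le _ _ hn0 _
        (rpow_neg_add_natCast_mul_le _ _ hn0 _ hScard hfiber) hsigns')
    obtain ⟨kk, hkk, hrow⟩ := exists_row_combination A i w k κ σ τ (n ^ B) hκB
    obtain ⟨Q, hQ, hmem⟩ := exists_isProperSymGAPSet r'
      (fun l => signedRow A i w k κ σ τ (!σ) (w' l) / k') (n ^ B') (Nat.one_le_pow _ _ hn0)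
    refine ⟨kk, J, Q, fun i₀ _ => ?_, hJ, hQ.mono (by omega) ?_, fun j hj => ?_⟩
    · have h1 : r * n ^ B ≤ n ^ E := by
        refine le_trans ?_ (hpow (B + r) (by omega))
        rw [pow_add, mul_comm]
        exact Nat.mul_le_mul_left _ (Nat.lt_pow_self (by omega)).le
      rw [Real.rpow_natCast]
      exact_mod_cast (hkk i₀).trans (by exact_mod_cast h1)
    · rw [Real.rpow_natCast]
      exact_mod_cast (properGAP_size_le_pow n r' B' hn2).trans (hpow _ (by omega))
    · obtain ⟨κ', hκB', heq⟩ := hκ' j hj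
      have hk0 : (k' : ℝ) ≠ 0 := by exact_mod_cast (by omega : k' ≠ 0)
      rw [Int.cast_natCast, hrow j]
      convert hmem κ' hκB' using 1
      simp only [← mul_div_assoc]
      rw [← Finset.sum_div, ← heq, mul_div_cancel_left₀ _ hk0]

end
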